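/- arXiv:1506.06930 — 2 statements merged into one kernel-verified Lean document; each statement's English description precedes it below -/
import Mathlib

section
/- Let f : ℝ^d → ℂ with Fourier transform supported in the ball {|ξ| ≤ K 2^j} for some j ∈ ℤ and K > 0. Then for γ ≥ 0 and 1 ≤ p ≤ q ≤ ∞, ‖(−Δ)^γ f‖_{L^q} ≤ C 2^{2γ j + jd(1/p − 1/q)} ‖f‖_{L^p}, with C depending only on γ, p, q, K, d. -/
open MeasureTheory Real FourierTransform ENNReal

noncomputable section

/-- `(−Δ)^γ`, the Fourier multiplier with symbol `|ξ|^{2γ}`, realized as an inverse Fourier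
integral. -/
def fracLapSq {d : ℕ} (γ : ℝ) (f : EuclideanSpace ℝ (Fin d) → ℂ) :
    EuclideanSpace ℝ (Fin d) → ℂ :=
  𝓕⁻ (fun ξ => ((‖ξ‖ ^ (2*γ) : ℝ) : ℂ) * 𝓕 f ξ)


theorem bern_pointwise {d : ℕ} (g F : EuclideanSpace ℝ (Fin d) → ℝ≥0∞) (hg : Measurable g)
    (hF : Measurable F) (P : ℝ) (hP : 1 ≤ P) (A : ℝ≥0∞) (hA : ∫⁻ y, g y ≤ A)
    (x : EuclideanSpace ℝ (Fin d)) :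
    (∫⁻ y, g (x - y) * F y) ^ P ≤ A ^ (P - 1) * ∫⁻ y, g (x - y) * F y ^ P := by
  have hP0 : 0 < P := by linarith
  have hgx : Measurable fun y => g (x - y) := hg.comp (measurable_const.sub measurable_id)
  have h := ENNReal.lintegral_mul_norm_pow_le (μ := volume) (f := fun y => g (x - y))
    (g := fun y => g (x - y) * F y ^ P) hgx.aemeasurable
    (hgx.mul (hF.pow_const P)).aemeasurable (p := 1 - 1/P) (q := 1/P)
    (by rw [sub_nonneg, div_le_one hP0]; exact hP) (by positivity) (by ring)
  have e : ∀ y, g (x - y) ^ (1 - 1/P) * (g (x - y) * F y ^ P) ^ (1/P) = g (x - y) * F y := by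
    intro y
    rw [ENNReal.mul_rpow_of_nonneg _ _ (by positivity), ← mul_assoc,
      ← ENNReal.rpow_add_of_nonneg _ _ (by rw [sub_nonneg, div_le_one hP0]; exact hP)
        (by positivity), ← ENNReal.rpow_mul, mul_one_div_cancel hP0.ne']
    simp
  simp only [e] at h
  have h1 : ∫⁻ y, g (x - y) = ∫⁻ y, g y := lintegral_sub_left_eq_self g x
  calc _ ≤ ((∫⁻ y, g (x - y)) ^ (1 - 1/P) * (∫⁻ y, g (x - y) * F y ^ P) ^ (1/P)) ^ P := by
        gcongr
    _ = (∫⁻ y, g y) ^ (P - 1) * ∫⁻ y, g (x - y) * F y ^ P := by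
        rw [ENNReal.mul_rpow_of_nonneg _ _ hP0.le, h1, ← ENNReal.rpow_mul, ← ENNReal.rpow_mul,
          one_div_mul_cancel hP0.ne', ENNReal.rpow_one]
        congr 2
        field_simp
    _ ≤ _ := by
        gcongr

theorem bern_young {d : ℕ} (h f u : EuclideanSpace ℝ (Fin d) → ℂ) (hh : Measurable h)
    (hf : Measurable f) (hum : Measurable u) (p q : ℝ≥0∞) (hp : 1 ≤ p) (hpq : p ≤ q) (A R : ℝ≥0∞)
    (hA : ∫⁻ y, ‖h y‖ₑ ≤ A) (hR : ∀ y, ‖h y‖ₑ ≤ A * R)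
    (hu : ∀ x, ‖u x‖ₑ ≤ ∫⁻ y, ‖h (x - y)‖ₑ * ‖f y‖ₑ) :
    eLpNorm u q volume ≤ A * R ^ (1/p.toReal - 1/q.toReal) * eLpNorm f p volume := by
  by_cases hpt : p = ∞
  · subst hpt
    have hq : q = ∞ := top_le_iff.1 hpq
    subst hq
    simp only [eLpNorm_exponent_top, ENNReal.toReal_top, sub_self, ENNReal.rpow_zero, mul_one]
    refine eLpNormEssSup_le_of_ae_enorm_bound (Filter.Eventually.of_forall fun x => ?_)
    calc _ ≤ _ := hu x
      _ ≤ ∫⁻ y, ‖h (x - y)‖ₑ * eLpNormEssSup f volume := by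
        apply lintegral_mono_ae
        filter_upwards [enorm_ae_le_eLpNormEssSup f volume] with y hy
        gcongr
      _ = (∫⁻ y, ‖h y‖ₑ) * eLpNormEssSup f volume := by
        rw [lintegral_mul_const _ (by fun_prop),
          lintegral_sub_left_eq_self (fun y => ‖h y‖ₑ) x]
      _ ≤ _ := by gcongr
  set P := p.toReal with hPdef
  have hP : 1 ≤ P := by
    have := ENNReal.toReal_mono hpt hp
    simpa using this
  have hP0 : 0 < P := by linarith
  have hp0 : p ≠ 0 := (lt_of_lt_of_le one_pos hp).ne'
  set N := ∫⁻ y, ‖f y‖ₑ ^ P with hN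
  have hfN : eLpNorm f p volume = N ^ (1/P) := by
    rw [eLpNorm_eq_lintegral_rpow_enorm_toReal hp0 hpt]
  have hAP : A ^ (P - 1) * A = A ^ P := by
    conv_lhs => rw [← ENNReal.rpow_one A, ← ENNReal.rpow_mul]
    rw [← ENNReal.rpow_add_of_nonneg _ _ (by linarith) (by linarith)]
    congr 1; ring
  have hpt1 : ∀ x, ‖u x‖ₑ ^ P ≤ A ^ (P - 1) * ∫⁻ y, ‖h (x - y)‖ₑ * ‖f y‖ₑ ^ P := fun x =>
    (ENNReal.rpow_le_rpow (hu x) hP0.le).trans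
      (bern_pointwise (fun y => ‖h y‖ₑ) (fun y => ‖f y‖ₑ) (by fun_prop) (by fun_prop) P hP A hA x)
  have hsup : ∀ x, ‖u x‖ₑ ^ P ≤ A ^ P * (R * N) := fun x => by
    refine (hpt1 x).trans ?_
    calc _ ≤ A ^ (P - 1) * ∫⁻ y, (A * R) * ‖f y‖ₑ ^ P := by
          gcongr with y; exact hR _
      _ = _ := by
          rw [lintegral_const_mul _ (by fun_prop), ← hAP]; ring
  by_cases hqt : q = ∞
  · subst hqt
    rw [hfN]
    simp only [eLpNorm_exponent_top, ENNReal.toReal_top, _root_.div_zero, sub_zero]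
    refine eLpNormEssSup_le_of_ae_enorm_bound (Filter.Eventually.of_forall fun x => ?_)
    have := ENNReal.rpow_le_rpow (hsup x) (z := 1/P) (by positivity)
    rw [ENNReal.mul_rpow_of_nonneg _ _ (by positivity), 
      ENNReal.mul_rpow_of_nonneg _ _ (by positivity), ← ENNReal.rpow_mul, ← ENNReal.rpow_mul,
      mul_one_div_cancel hP0.ne', ENNReal.rpow_one, ENNReal.rpow_one, ← mul_assoc] at this
    exact this
  have hint : ∫⁻ x, ‖u x‖ₑ ^ P ≤ A ^ P * N := by
    calc _ ≤ ∫⁻ x, A ^ (P - 1) * ∫⁻ y, ‖h (x - y)‖ₑ * ‖f y‖ₑ ^ P := lintegral_mono hpt1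
      _ = A ^ (P - 1) * ∫⁻ x, ∫⁻ y, ‖h (x - y)‖ₑ * ‖f y‖ₑ ^ P := by
          rw [lintegral_const_mul _ (Measurable.lintegral_prod_right'
            (f := fun z : EuclideanSpace ℝ (Fin d) × EuclideanSpace ℝ (Fin d) =>
              ‖h (z.1 - z.2)‖ₑ * ‖f z.2‖ₑ ^ P) (by fun_prop))]
      _ = A ^ (P - 1) * ∫⁻ y, ∫⁻ x, ‖h (x - y)‖ₑ * ‖f y‖ₑ ^ P := by
          rw [lintegral_lintegral_swap (by fun_prop)]
      _ = A ^ (P - 1) * ∫⁻ y, (∫⁻ x, ‖h x‖ₑ) * ‖f y‖ₑ ^ P := by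
          congr 2; ext y
          rw [lintegral_mul_const _ (by fun_prop),
            lintegral_sub_right_eq_self (fun x => ‖h x‖ₑ) y]
      _ ≤ A ^ (P - 1) * ∫⁻ y, A * ‖f y‖ₑ ^ P := by gcongr
      _ = _ := by rw [lintegral_const_mul _ (by fun_prop), ← hAP]; ring
  set Q := q.toReal with hQdef
  have hPQ : P ≤ Q := ENNReal.toReal_mono hqt hpq
  have hQ0 : 0 < Q := by linarith
  have hq0 : q ≠ 0 := (lt_of_lt_of_le one_pos (hp.trans hpq)).ne'
  have hs : 0 ≤ Q / P - 1 := by rw [sub_nonneg, le_div_iff₀ hP0]; linarith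
  have hQint : ∫⁻ x, ‖u x‖ₑ ^ Q ≤ (A ^ P * (R * N)) ^ (Q / P - 1) * (A ^ P * N) := by
    calc _ ≤ ∫⁻ x, (A ^ P * (R * N)) ^ (Q / P - 1) * ‖u x‖ₑ ^ P := by
          apply lintegral_mono
          intro x
          have : ‖u x‖ₑ ^ Q = (‖u x‖ₑ ^ P) ^ (Q / P - 1) * ‖u x‖ₑ ^ P := by
            rw [← ENNReal.rpow_mul, ← ENNReal.rpow_add_of_nonneg _ _ (by positivity) hP0.le]
            congr 1; field_simp; ring
          simp only [this]
          gcongr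
          exact hsup x
      _ ≤ (A ^ P * (R * N)) ^ (Q / P - 1) * ∫⁻ x, ‖u x‖ₑ ^ P := by
          rw [lintegral_const_mul _ (by fun_prop)]
      _ ≤ _ := by gcongr
  rw [hfN, eLpNorm_eq_lintegral_rpow_enorm_toReal hq0 hqt, ← hQdef]
  refine (ENNReal.rpow_le_rpow hQint (z := 1/Q) (by positivity)).trans (le_of_eq ?_)
  have hs2 : 0 ≤ (Q/P - 1) * (1/Q) := by positivity
  have e1 : (Q/P - 1) * (1/Q) = 1/P - 1/Q := by field_simp
  rw [ENNReal.mul_rpow_of_nonneg _ _ (by positivity : 0 ≤ 1/Q), ← ENNReal.rpow_mul,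
    ENNReal.mul_rpow_of_nonneg _ _ hs2, ENNReal.mul_rpow_of_nonneg _ _ hs2,
    ENNReal.mul_rpow_of_nonneg _ _ (by positivity : 0 ≤ 1/Q), ← ENNReal.rpow_mul,
    ← ENNReal.rpow_mul, e1]
  rw [e1] at hs2
  have eA : A ^ (P * (1/P - 1/Q)) * A ^ (P * (1/Q)) = A := by
    rw [← ENNReal.rpow_add_of_nonneg _ _ (by positivity) (by positivity)]
    rw [show P * (1/P - 1/Q) + P * (1/Q) = 1 by field_simp; ring, ENNReal.rpow_one]
  have eN : N ^ (1/P - 1/Q) * N ^ (1/Q) = N ^ (1/P) := by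
    rw [← ENNReal.rpow_add_of_nonneg _ _ hs2 (by positivity)]
    congr 1; ring
  rw [← eN]
  nth_rw 3 [← eA]
  ring

theorem bern_lintegral_smul {d : ℕ} (g : EuclideanSpace ℝ (Fin d) → ℝ≥0∞) (hg : Measurable g)
    (c : ℝ) (hc : 0 < c) :
    ∫⁻ x, g (c • x) = ENNReal.ofReal ((c ^ d)⁻¹) * ∫⁻ x, g x := by
  rw [← lintegral_map (μ := volume) (g := fun x : EuclideanSpace ℝ (Fin d) => c • x) hg
    (measurable_const_smul c), Measure.map_addHaar_smul _ hc.ne', lintegral_smul_measure,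
    finrank_euclideanSpace_fin, abs_of_pos (by positivity), smul_eq_mul]

theorem bern_fourierInv_smul {d : ℕ} (g : EuclideanSpace ℝ (Fin d) → ℂ)
    (c : ℝ) (hc : 0 < c) (x : EuclideanSpace ℝ (Fin d)) :
    𝓕⁻ (fun ξ => g (c • ξ)) x = ((c ^ d)⁻¹ : ℝ) • 𝓕⁻ g (c⁻¹ • x) := by
  rw [Real.fourierInv_eq, Real.fourierInv_eq]
  have := Measure.integral_comp_smul volume
    (fun η : EuclideanSpace ℝ (Fin d) => Real.fourierChar (inner ℝ η (c⁻¹ • x)) • g η) c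
  rw [finrank_euclideanSpace_fin, abs_of_pos (by positivity)] at this
  rw [← this]
  congr 1; ext ξ
  rw [inner_smul_left, inner_smul_right]
  congr 3
  simp only [conj_trivial]
  field_simp

theorem bern_fourierInv_cont {d : ℕ} (g : EuclideanSpace ℝ (Fin d) → ℂ) (hg : Integrable g) :
    Continuous (𝓕⁻ g) :=
  VectorFourier.fourierIntegral_continuous Real.continuous_fourierChar
    ((continuous_inner (𝕜 := ℝ) (E := EuclideanSpace ℝ (Fin d))).neg) hg

theorem bern_norm_smul {d : ℕ} (g : EuclideanSpace ℝ (Fin d) → ℂ) (hg : Integrable g)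
    (c : ℝ) (hc : 0 < c) :
    ∫⁻ x, ‖𝓕⁻ (fun ξ => g (c • ξ)) x‖ₑ = ∫⁻ x, ‖𝓕⁻ g x‖ₑ := by
  have hm : Measurable (fun x => ‖𝓕⁻ g x‖ₑ) :=
    (bern_fourierInv_cont g hg).measurable.enorm
  simp_rw [bern_fourierInv_smul g c hc, enorm_smul]
  rw [lintegral_const_mul _ (by
    exact hm.comp (measurable_const_smul c⁻¹)), 
    bern_lintegral_smul (fun x => ‖𝓕⁻ g x‖ₑ) hm c⁻¹ (by positivity), ← mul_assoc,
    Real.enorm_of_nonneg (by positivity), ← ENNReal.ofReal_mul (by positivity), inv_pow,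
    mul_inv_cancel₀ (by positivity), ENNReal.ofReal_one, one_mul]

theorem bern_enorm_fourierInv_le {d : ℕ} (g : EuclideanSpace ℝ (Fin d) → ℂ)
    (x : EuclideanSpace ℝ (Fin d)) : ‖𝓕⁻ g x‖ₑ ≤ ∫⁻ ξ, ‖g ξ‖ₑ := by
  rw [Real.fourierInv_eq]
  refine (enorm_integral_le_lintegral_enorm _).trans (le_of_eq ?_)
  congr 1; ext ξ
  rw [← ofReal_norm, ← ofReal_norm, Circle.norm_smul]

theorem bern_conv {d : ℕ} (m f : EuclideanSpace ℝ (Fin d) → ℂ) (hm : Integrable m)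
    (hf : Integrable f) (x : EuclideanSpace ℝ (Fin d)) :
    𝓕⁻ (fun ξ => m ξ * 𝓕 f ξ) x = ∫ y, f y * 𝓕⁻ m (x - y) := by
  have hi : Integrable (fun ξ => Real.fourierChar (inner ℝ ξ x) • m ξ) := by
    have := (Real.fourierIntegral_convergent_iff (f := m) (-x)).2 hm
    simpa using this
  have h := VectorFourier.integral_fourierIntegral_smul_eq_flip (L := innerₗ (EuclideanSpace ℝ (Fin d)))
    (μ := volume) (ν := volume) (e := Real.fourierChar) (f := f)
    (g := fun ξ => Real.fourierChar (inner ℝ ξ x) • m ξ) Real.continuous_fourierChar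
    continuous_inner hf hi
  rw [Real.fourierInv_eq]
  calc _ = _ := by
        congr 1; ext ξ
        rw [mul_comm, ← smul_eq_mul, smul_comm]
        rfl
    _ = _ := h
    _ = _ := by
        congr 1; ext y
        rw [smul_eq_mul, Real.fourierInv_eq]
        congr 1
        rw [VectorFourier.fourierIntegral]
        congr 1; ext ξ
        rw [smul_smul, ← AddChar.map_add_eq_mul, inner_sub_right]
        congr 2
        simp [real_inner_comm]
        ring

theorem bern_smooth {d : ℕ} (g : EuclideanSpace ℝ (Fin d) → ℂ) (hg : HasCompactSupport g)
    (hs : ContDiff ℝ (⊤ : ℕ∞) g) : Integrable g ∧ ∫⁻ x, ‖𝓕⁻ g x‖ₑ < ∞ := by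
  refine ⟨hs.continuous.integrable_of_hasCompactSupport hg, ?_⟩
  have h := (𝓕⁻ (hg.toSchwartzMap hs)).integrable (μ := volume)
  have h2 := h.2
  rw [SchwartzMap.fourierInv_coe] at h2
  exact h2

theorem bern_symbol {d : ℕ} (γ : ℝ) (hγ : 0 ≤ γ) (K : ℝ) (hK : 0 < K) :
    ∃ m : EuclideanSpace ℝ (Fin d) → ℂ, Continuous m ∧ Integrable m ∧ ∫⁻ x, ‖𝓕⁻ m x‖ₑ < ∞ ∧
      ∀ ξ, ‖ξ‖ ≤ K → m ξ = ((‖ξ‖ ^ (2*γ) : ℝ) : ℂ) := by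
  let φ : ContDiffBump (0 : EuclideanSpace ℝ (Fin d)) := ⟨K, 2*K, hK, by linarith⟩
  have hφ1 : ∀ ξ, ‖ξ‖ ≤ K → φ ξ = 1 := fun ξ h =>
    φ.one_of_mem_closedBall (by simpa using h)
  have hφ0 : ∀ ξ, 2*K ≤ ‖ξ‖ → φ ξ = 0 := fun ξ h =>
    φ.zero_of_le_dist (by simpa using h)
  have hφs : ContDiff ℝ (⊤ : ℕ∞) φ := φ.contDiff
  have hcs : ∀ g : EuclideanSpace ℝ (Fin d) → ℂ, (∀ ξ, 2*K ≤ ‖ξ‖ → g ξ = 0) →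
      HasCompactSupport g := fun g hg =>
    HasCompactSupport.intro (isCompact_closedBall 0 (2*K)) (fun x hx => hg x (by
      simp only [Metric.mem_closedBall, dist_zero_right, not_le] at hx; exact hx.le))
  rcases hγ.eq_or_lt with rfl | hγ
  · obtain ⟨h1, h2⟩ := bern_smooth (fun ξ => ((φ ξ : ℝ) : ℂ))
      (hcs _ fun ξ h => by simp [hφ0 ξ h]) (Complex.ofRealCLM.contDiff.comp hφs)
    exact ⟨_, Complex.continuous_ofReal.comp hφs.continuous, h1, h2, fun ξ h => by simp [hφ1 ξ h]⟩
  have h2γ : 2*γ ≠ 0 := by positivity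
  let ψ : EuclideanSpace ℝ (Fin d) → ℂ := fun ξ =>
    ((‖ξ‖ ^ (2*γ) * (φ ξ - φ ((2:ℝ) • ξ)) : ℝ) : ℂ)
  have hψs : ContDiff ℝ (⊤ : ℕ∞) ψ := by
    refine Complex.ofRealCLM.contDiff.comp ?_
    rw [contDiff_iff_contDiffAt]
    intro ξ
    by_cases hξ : ξ = 0
    · subst hξ
      have : (fun ξ => ‖ξ‖ ^ (2*γ) * (φ ξ - φ ((2:ℝ) • ξ))) =ᶠ[nhds 0] fun _ => (0:ℝ) := by
        filter_upwards [Metric.ball_mem_nhds (0 : EuclideanSpace ℝ (Fin d)) (half_pos hK)] with ξ h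
        have h : ‖ξ‖ < K/2 := by simpa using h
        rw [hφ1 ξ (by linarith), hφ1 _ (by rw [norm_smul]; norm_num; linarith)]
        simp
      exact contDiffAt_const.congr_of_eventuallyEq this
    · refine ContDiffAt.mul ?_ ?_
      · exact ContDiffAt.rpow_const_of_ne (contDiffAt_norm ℝ hξ) (by simpa using hξ)
      · exact (hφs.sub (hφs.comp (contDiff_const_smul (2:ℝ)))).contDiffAt
  obtain ⟨hψi, hψf⟩ := bern_smooth ψ (hcs _ fun ξ h => by
    simp only [ψ]
    rw [hφ0 ξ h, hφ0 _ (by rw [norm_smul]; norm_num; linarith)]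
    simp) hψs
  let m : EuclideanSpace ℝ (Fin d) → ℂ := fun ξ => ((‖ξ‖ ^ (2*γ) * φ ξ : ℝ) : ℂ)
  have hmc : Continuous m := by
    refine Complex.continuous_ofReal.comp (Continuous.mul ?_ hφs.continuous)
    exact continuous_norm.rpow_const fun _ => Or.inr (by positivity)
  have hmi : Integrable m :=
    hmc.integrable_of_hasCompactSupport (hcs _ fun ξ h => by simp [m, hφ0 ξ h])
  refine ⟨m, hmc, hmi, ?_, fun ξ h => by simp [m, hφ1 ξ h]⟩
  let b : ℝ := 2 ^ (-(2*γ))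
  have hb0 : 0 < b := by positivity
  have hb1 : b < 1 := Real.rpow_lt_one_of_one_lt_of_neg (by norm_num) (by linarith)
  let F : ℕ → EuclideanSpace ℝ (Fin d) → ℂ := fun k ξ => ((b ^ k : ℝ) : ℂ) * ψ ((2:ℝ)^k • ξ)
  have hF : ∀ k ξ, F k ξ =
      ((‖ξ‖ ^ (2*γ) * (φ ((2:ℝ)^k • ξ) - φ ((2:ℝ)^(k+1) • ξ)) : ℝ) : ℂ) := by
    intro k ξ
    simp only [F, ψ]
    rw [← Complex.ofReal_mul, norm_smul, smul_smul, ← pow_succ', ← mul_assoc]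
    congr 2
    rw [Real.norm_of_nonneg (by positivity), Real.mul_rpow (by positivity) (by positivity),
      ← mul_assoc, ← Real.rpow_natCast, ← Real.rpow_natCast, ← Real.rpow_mul (by positivity),
      ← Real.rpow_mul (by positivity), ← Real.rpow_add (by positivity)]
    rw [show -(2*γ) * (k:ℝ) + (k:ℝ) * (2*γ) = 0 by ring]
    simp
  have hsum : ∀ ξ, m ξ = ∑' k, F k ξ := by
    intro ξ
    by_cases hξ : ξ = 0
    · subst hξ
      simp [hF, m, h2γ]
    have hn : 0 < ‖ξ‖ := norm_pos_iff.2 hξ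
    obtain ⟨n, hnn⟩ := pow_unbounded_of_one_lt (2*K/‖ξ‖) (one_lt_two : (1:ℝ) < 2)
    have hz : ∀ k, n ≤ k → φ ((2:ℝ)^k • ξ) = 0 := fun k hk => hφ0 _ (by
      rw [norm_smul, Real.norm_of_nonneg (by positivity)]
      rw [div_lt_iff₀ hn] at hnn
      refine hnn.le.trans ?_
      gcongr
      norm_num)
    rw [tsum_eq_sum (s := Finset.range n)]
    · simp_rw [hF]
      rw [← Complex.ofReal_sum, ← Finset.mul_sum,
        Finset.sum_range_sub' (fun k => φ ((2:ℝ)^k • ξ)), hz n le_rfl]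
      simp [m]
    · intro k hk
      simp only [Finset.mem_range, not_lt] at hk
      rw [hF, hz k hk, hz (k+1) (by omega)]
      simp
  have hψc : ∀ k : ℕ, Continuous fun ξ => ψ ((2:ℝ)^k • ξ) := fun k =>
    hψs.continuous.comp (continuous_const_smul _)
  have hFc : ∀ k, Continuous (F k) := fun k => continuous_const.mul (hψc k)
  have hgeo : ∑' k : ℕ, ENNReal.ofReal (b^k) < ∞ := by
    rw [← ENNReal.ofReal_tsum_of_nonneg (fun k => by positivity)
      (summable_geometric_of_lt_one hb0.le hb1)]
    exact ENNReal.ofReal_lt_top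
  have hFn : ∀ k, ∫⁻ ξ, ‖F k ξ‖ₑ ≤ ENNReal.ofReal (b^k) * ∫⁻ ξ, ‖ψ ξ‖ₑ := by
    intro k
    simp only [F, enorm_mul]
    rw [lintegral_const_mul _ (hψc k).measurable.enorm,
      bern_lintegral_smul (fun ξ => ‖ψ ξ‖ₑ) hψs.continuous.measurable.enorm _ (by positivity)]
    rw [← ofReal_norm, Complex.norm_real, Real.norm_of_nonneg (by positivity)]
    gcongr
    refine mul_le_of_le_one_left (by positivity) ?_
    rw [ENNReal.ofReal_le_one]
    exact inv_le_one_of_one_le₀ (one_le_pow₀ (one_le_pow₀ (by norm_num)))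
  have hfin : ∑' k, ∫⁻ ξ, ‖F k ξ‖ₑ ≠ ∞ := by
    refine ((ENNReal.tsum_le_tsum hFn).trans_lt ?_).ne
    rw [ENNReal.tsum_mul_right]
    exact ENNReal.mul_lt_top hgeo hψi.2
  have hinv : ∀ x, 𝓕⁻ m x = ∑' k, 𝓕⁻ (F k) x := by
    intro x
    simp_rw [Real.fourierInv_eq]
    rw [← integral_tsum]
    · congr 1; ext ξ
      rw [hsum ξ, Circle.smul_def, smul_eq_mul, ← tsum_mul_left]
      rfl
    · intro k
      have : Continuous fun ξ => Real.fourierChar (inner ℝ ξ x) • F k ξ := by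
        have := hFc k
        fun_prop
      exact this.aestronglyMeasurable
    · refine ne_of_eq_of_ne ?_ hfin
      congr 1; ext k
      congr 1; ext ξ
      rw [← ofReal_norm, ← ofReal_norm, Circle.norm_smul]
  have hFinv : ∀ k, 𝓕⁻ (F k) = fun x => ((b^k : ℝ) : ℂ) * 𝓕⁻ (fun ξ => ψ ((2:ℝ)^k • ξ)) x := by
    intro k
    ext x
    rw [Real.fourierInv_eq, Real.fourierInv_eq, ← integral_const_mul]
    congr 1; ext ξ
    simp only [F, Circle.smul_def, smul_eq_mul]
    ring
  have hψk : ∀ k : ℕ, Integrable fun ξ => ψ ((2:ℝ)^k • ξ) := fun k =>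
    hψi.comp_smul (by positivity)
  calc ∫⁻ x, ‖𝓕⁻ m x‖ₑ ≤ ∫⁻ x, ∑' k, ‖𝓕⁻ (F k) x‖ₑ := by
        apply lintegral_mono
        intro x
        simp only [hinv x]
        exact enorm_tsum_le_tsum_enorm
    _ = ∑' k, ∫⁻ x, ‖𝓕⁻ (F k) x‖ₑ := by
        refine lintegral_tsum fun k => ?_
        exact (bern_fourierInv_cont _ ((hψk k).const_mul _)).measurable.enorm.aemeasurable
    _ = ∑' k, ENNReal.ofReal (b^k) * ∫⁻ x, ‖𝓕⁻ ψ x‖ₑ := by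
        congr 1; ext k
        simp only [hFinv k, enorm_mul]
        rw [lintegral_const_mul _ (bern_fourierInv_cont _ (hψk k)).measurable.enorm,
          bern_norm_smul ψ hψi _ (by positivity),
          ← ofReal_norm, Complex.norm_real, Real.norm_of_nonneg (by positivity)]
    _ < ∞ := by
        rw [ENNReal.tsum_mul_right]
        exact ENNReal.mul_lt_top hgeo hψf

/-- Bernstein inequality: if `𝓕f` is supported in the ball `{|ξ| ≤ K 2ʲ}`
then for `γ ≥ 0` and `1 ≤ p ≤ q ≤ ∞`,
`‖(−Δ)^γ f‖_{L^q} ≤ C 2^{2γj + jd(1/p − 1/q)} ‖f‖_{L^p}` with `C = C(γ, p, q, K, d)`. -/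
theorem stmt_9 (d : ℕ) (γ : ℝ) (hγ : 0 ≤ γ) (p q : ℝ≥0∞)
    (hp : 1 ≤ p) (hpq : p ≤ q) (K : ℝ) (hK : 0 < K) :
    ∃ C : ℝ, 0 < C ∧
      ∀ (j : ℤ) (f : SchwartzMap (EuclideanSpace ℝ (Fin d)) ℂ),
        (∀ ξ : EuclideanSpace ℝ (Fin d), K * 2^(j:ℝ) < ‖ξ‖ → 𝓕 (fun x => f x) ξ = 0) →
        eLpNorm (fracLapSq γ (fun x => f x)) q volume
          ≤ ENNReal.ofReal
              (C * 2 ^ (2*γ*(j:ℝ) + (j:ℝ)*(d:ℝ)*(1/p.toReal - 1/q.toReal)))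
            * eLpNorm (fun x => f x) p volume := by
  obtain ⟨m, hmcont, hmi, hmf, hmK⟩ := bern_symbol (d := d) γ hγ K hK
  set A0 : ℝ := max 1 (max (∫⁻ x, ‖𝓕⁻ m x‖ₑ).toReal (∫⁻ x, ‖m x‖ₑ).toReal) with hA0
  have hA0p : 0 < A0 := lt_of_lt_of_le one_pos (le_max_left _ _)
  have hA1 : ∫⁻ x, ‖𝓕⁻ m x‖ₑ ≤ ENNReal.ofReal A0 := by
    rw [← ENNReal.ofReal_toReal hmf.ne]
    exact ENNReal.ofReal_le_ofReal ((le_max_left _ _).trans (le_max_right _ _))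
  have hA2 : ∫⁻ x, ‖m x‖ₑ ≤ ENNReal.ofReal A0 := by
    rw [← ENNReal.ofReal_toReal hmi.2.ne]
    exact ENNReal.ofReal_le_ofReal ((le_max_right _ _).trans (le_max_right _ _))
  refine ⟨A0, hA0p, fun j f hf => ?_⟩
  set c : ℝ := 2 ^ (j:ℝ) with hc
  have hc0 : 0 < c := by positivity
  let n : EuclideanSpace ℝ (Fin d) → ℂ := fun ξ => ((c ^ (2*γ) : ℝ) : ℂ) * m (c⁻¹ • ξ)
  have hmc : Integrable fun ξ => m (c⁻¹ • ξ) := hmi.comp_smul (by positivity)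
  have hni : Integrable n := hmc.const_mul _
  have hfi : Integrable (fun x => f x) := f.integrable
  have hfrac : fracLapSq γ (fun x => f x) = 𝓕⁻ (fun ξ => n ξ * 𝓕 (fun x => f x) ξ) := by
    unfold fracLapSq
    congr 1
    ext ξ
    by_cases hξ : K * c < ‖ξ‖
    · rw [hf ξ hξ]; simp
    · congr 1
      have h1 : ‖c⁻¹ • ξ‖ = c⁻¹ * ‖ξ‖ := by
        rw [norm_smul, Real.norm_of_nonneg (by positivity)]
      have h2 : ‖c⁻¹ • ξ‖ ≤ K := by
        rw [h1, inv_mul_le_iff₀ hc0]; linarith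
      simp only [n]
      rw [hmK _ h2, h1, ← Complex.ofReal_mul, ← Real.mul_rpow hc0.le (by positivity),
        mul_inv_cancel_left₀ hc0.ne']
  have hninv : 𝓕⁻ n = fun x => ((c ^ (2*γ) : ℝ) : ℂ) * 𝓕⁻ (fun ξ => m (c⁻¹ • ξ)) x := by
    ext x
    rw [Real.fourierInv_eq, Real.fourierInv_eq, ← integral_const_mul]
    congr 1; ext ξ
    simp only [n, Circle.smul_def, smul_eq_mul]
    ring
  have hce : ‖((c ^ (2*γ) : ℝ) : ℂ)‖ₑ = ENNReal.ofReal (c ^ (2*γ)) := by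
    rw [← ofReal_norm, Complex.norm_real, Real.norm_of_nonneg (by positivity)]
  have hsc : ∫⁻ ξ, ‖m (c⁻¹ • ξ)‖ₑ = ENNReal.ofReal (c ^ d) * ∫⁻ ξ, ‖m ξ‖ₑ := by
    rw [bern_lintegral_smul (fun ξ => ‖m ξ‖ₑ) hmcont.measurable.enorm c⁻¹ (by positivity),
      inv_pow, inv_inv]
  have hconv : ∀ x, fracLapSq γ (fun x => f x) x = ∫ y, f y * 𝓕⁻ n (x - y) := fun x => by
    rw [hfrac]; exact bern_conv n _ hni hfi x
  have hum : Measurable (fracLapSq γ (fun x => f x)) := by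
    rw [hfrac]
    refine (bern_fourierInv_cont _ ?_).measurable
    refine hni.mul_bdd (c := ∫ x, ‖f x‖) ?_ ?_
    · have := (𝓕 f).continuous
      rw [SchwartzMap.fourier_coe] at this
      exact this.aestronglyMeasurable
    · exact Filter.Eventually.of_forall fun ξ =>
        VectorFourier.norm_fourierIntegral_le_integral_norm _ _ _ _ _
  have key := bern_young (𝓕⁻ n) (fun x => f x) (fracLapSq γ (fun x => f x))
    (bern_fourierInv_cont n hni).measurable f.continuous.measurable hum p q hp hpq
    (ENNReal.ofReal (c ^ (2*γ)) * ENNReal.ofReal A0) (ENNReal.ofReal (c ^ d)) (by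
      simp only [hninv, enorm_mul, hce]
      rw [lintegral_const_mul _ (bern_fourierInv_cont _ hmc).measurable.enorm,
        bern_norm_smul m hmi c⁻¹ (by positivity)]
      gcongr) (fun y => by
      simp only [hninv, enorm_mul, hce]
      rw [mul_assoc]
      gcongr
      refine (bern_enorm_fourierInv_le _ y).trans ?_
      rw [hsc, mul_comm]
      gcongr) (fun x => by
      rw [hconv x]
      refine (enorm_integral_le_lintegral_enorm _).trans (le_of_eq ?_)
      congr 1; ext y
      rw [enorm_mul, mul_comm])
  refine key.trans (le_of_eq ?_)
  congr 1
  rw [ENNReal.ofReal_rpow_of_pos (by positivity), ← ENNReal.ofReal_mul (by positivity),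
    ← ENNReal.ofReal_mul (by positivity)]
  congr 1
  rw [Real.rpow_add (by norm_num), hc, ← Real.rpow_natCast, ← Real.rpow_mul (by positivity),
    ← Real.rpow_mul (by positivity), ← Real.rpow_mul (by positivity)]
  rw [mul_comm _ A0, mul_assoc]
  congr 3 <;> ring
end
end

section
/- Let ℛ = Λ^{−1} div and let u be a smooth divergence-free vector field and v a smooth vector field on ℝ², all rapidly decaying. For every s > 2 and ι ∈ (0, s−2) the commutator satisfies ‖ℛ(u·∇v) − u·∇(ℛv)‖_{Ḣ^{s−1}} ≤ C ( ‖u‖_{L^∞} ‖v‖_{Ḣ^s} + ‖∇v‖_{H^{1+ι}} ‖u‖_{Ḣ^{s−1}} ). -/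
open MeasureTheory Real FourierTransform ENNReal

noncomputable section

/-- The homogeneous Sobolev norm `‖f‖_{Ḣ^σ} = ‖Λ^σ f‖_{L²}`, expressed on the Fourier side
via Plancherel as `‖ |ξ|^σ 𝓕f(ξ) ‖_{L²}`. -/
def hdotNorm {d : ℕ} (σ : ℝ) (f : EuclideanSpace ℝ (Fin d) → ℂ) : ℝ≥0∞ :=
  eLpNorm (fun ξ => ‖ξ‖ ^ σ * ‖𝓕 f ξ‖) 2 volume

/-- The inhomogeneous Sobolev norm `‖f‖_{H^σ} = ‖f‖_{L²} + ‖Λ^σ f‖_{L²}`. -/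
def sobNorm {d : ℕ} (σ : ℝ) (f : EuclideanSpace ℝ (Fin d) → ℂ) : ℝ≥0∞ :=
  eLpNorm f 2 volume + hdotNorm σ f

/-- The operator `ℛ = Λ^{−1} div` on vector fields `w : ℝ² → ℝ²`, realized as the inverse
Fourier transform of `ξ ↦ i ξ·ŵ(ξ)/|ξ|`. -/
def rieszDiv (w : EuclideanSpace ℝ (Fin 2) → EuclideanSpace ℝ (Fin 2)) :
    EuclideanSpace ℝ (Fin 2) → ℂ :=
  𝓕⁻ (fun ξ => Complex.I * (∑ i : Fin 2, (ξ i : ℂ) * 𝓕 (fun x => (w x i : ℂ)) ξ) / (‖ξ‖ : ℂ))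


local notation "E2" => EuclideanSpace ℝ (Fin 2)

open scoped RealInnerProductSpace SchwartzMap
open Filter Topology

lemma aux_conv_fourier {f h : E2 → ℂ} (hf : Integrable f) (hh : Integrable h) (ξ : E2) :
    𝓕 (fun x => f x * 𝓕⁻ h x) ξ = ∫ η, 𝓕 f (ξ - η) * h η := by
  have hg : Integrable (fun x => 𝐞 (-⟪x, ξ⟫) • f x) :=
    (Real.fourierIntegral_convergent_iff ξ).2 hf
  have hL : Continuous fun p : E2 × E2 ↦ (-innerₗ E2) p.1 p.2 := by
    simp only [LinearMap.neg_apply, innerₗ_apply_apply]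
    fun_prop
  have key := VectorFourier.integral_fourierIntegral_smul_eq_flip (μ := volume) (ν := volume)
    (L := -innerₗ E2) (e := 𝐞) (f := h) (g := fun x => 𝐞 (-⟪x, ξ⟫) • f x)
    Real.continuous_fourierChar hL hh hg
  rw [Real.fourier_eq]
  calc ∫ v, 𝐞 (-⟪v, ξ⟫) • (f v * 𝓕⁻ h v) = _ := by
        refine integral_congr_ae (Eventually.of_forall fun v => ?_)
        change _ = 𝓕⁻ h v • (𝐞 (-⟪v, ξ⟫) • f v)
        simp only [Circle.smul_def, smul_eq_mul]
        ring
    _ = _ := key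
    _ = _ := by
        refine integral_congr_ae (Eventually.of_forall fun v => ?_)
        simp only [smul_eq_mul]
        rw [mul_comm]
        congr 1
        rw [Real.fourier_eq]
        unfold VectorFourier.fourierIntegral
        refine integral_congr_ae (Eventually.of_forall fun x => ?_)
        simp only [smul_smul]
        congr 1
        rw [← AddChar.map_add_eq_mul]
        congr 1
        simp [inner_sub_right, real_inner_comm]
        ring

lemma aux_conv_fourierInv {f h : E2 → ℂ} (hf : Integrable f) (hh : Integrable h) (x : E2) :
    𝓕⁻ (fun ξ => f ξ * 𝓕 h ξ) x = ∫ y, 𝓕 f (y - x) * h y := by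
  have h1 : 𝓕 h = 𝓕⁻ (fun y => h (-y)) := by
    rw [Real.fourierInv_eq_fourier_comp_neg]; simp
  rw [h1, Real.fourierInv_eq_fourier_neg, aux_conv_fourier hf hh.comp_neg,
    ← integral_neg_eq_self]
  simp [sub_eq_add_neg, add_comm]

lemma aux_plancherel (f : 𝓢(E2, ℂ)) : eLpNorm (𝓕 (f : E2 → ℂ)) 2 volume = eLpNorm f 2 volume := by
  have h := MeasureTheory.Lp.norm_fourier_eq (f.toLp 2)
  rw [SchwartzMap.toLp_fourier_eq, SchwartzMap.norm_toLp, SchwartzMap.norm_toLp] at h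
  rw [← SchwartzMap.fourier_coe]
  have h1 : eLpNorm ((𝓕 f : 𝓢(E2, ℂ)) : E2 → ℂ) 2 volume ≠ ⊤ :=
    (SchwartzMap.memLp (𝓕 f : 𝓢(E2, ℂ)) 2 volume).2.ne
  have h2 : eLpNorm (f : E2 → ℂ) 2 volume ≠ ⊤ := (f.memLp 2 volume).2.ne
  exact (ENNReal.toReal_eq_toReal_iff' h1 h2).1 h

lemma aux_plancherel_inv (f : 𝓢(E2, ℂ)) :
    eLpNorm (𝓕⁻ (f : E2 → ℂ)) 2 volume = eLpNorm f 2 volume := by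
  have h := aux_plancherel (𝓕⁻ f)
  rw [← SchwartzMap.fourier_coe, FourierTransform.fourier_fourierInv_eq] at h
  rw [← SchwartzMap.fourierInv_coe, h]

lemma aux_conv_schwartz (F H : 𝓢(E2, ℂ)) (M : ℝ≥0∞) (hM : ∀ x, ‖𝓕⁻ (F : E2 → ℂ) x‖ₑ ≤ M) :
    eLpNorm (fun ξ => ∫ η, F (ξ - η) * H η) 2 volume ≤ M * eLpNorm H 2 volume := by
  have h1 : (fun ξ => ∫ η, F (ξ - η) * H η) =
      𝓕 (fun x => (𝓕⁻ F : 𝓢(E2, ℂ)) x * 𝓕⁻ (H : E2 → ℂ) x) := by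
    funext ξ
    rw [aux_conv_fourier (𝓕⁻ F).integrable H.integrable, ← SchwartzMap.fourier_coe,
      FourierTransform.fourier_fourierInv_eq]
  let G : 𝓢(E2, ℂ) := SchwartzMap.smulLeftCLM ℂ (𝓕⁻ F : 𝓢(E2, ℂ)) (𝓕⁻ H)
  have h2 : (fun x => (𝓕⁻ F : 𝓢(E2, ℂ)) x * 𝓕⁻ (H : E2 → ℂ) x) = (G : E2 → ℂ) := by
    funext x
    simp only [G]
    rw [SchwartzMap.smulLeftCLM_apply_apply (SchwartzMap.hasTemperateGrowth _), smul_eq_mul,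
      SchwartzMap.fourierInv_coe H]
  rw [h1, h2, aux_plancherel, ← aux_plancherel_inv H]
  have h3 : ∀ᵐ x, ‖G x‖ₑ ≤ M * ‖𝓕⁻ (H : E2 → ℂ) x‖ₑ := by
    refine Eventually.of_forall fun x => ?_
    rw [← h2]
    simp only [enorm_mul]
    gcongr
    rw [SchwartzMap.fourierInv_coe]
    exact hM x
  by_cases hMt : M = ⊤
  · subst hMt
    by_cases h0 : eLpNorm (𝓕⁻ (H : E2 → ℂ)) 2 volume = 0
    · rw [h0, mul_zero]
      rw [aux_plancherel_inv] at h0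
      have hH : (H : E2 → ℂ) =ᵐ[volume] 0 :=
        (eLpNorm_eq_zero_iff H.continuous.aestronglyMeasurable (by norm_num)).1 h0
      have : (G : E2 → ℂ) = 0 := by
        funext x
        rw [← h2]
        simp only [Pi.zero_apply, mul_eq_zero]
        right
        rw [Real.fourierInv_congr_ae hH]
        simp [Real.fourierInv_eq]
      rw [this]; simp
    · rw [ENNReal.top_mul h0]; exact le_top
  · lift M to NNReal using hMt
    exact eLpNorm_le_nnreal_smul_eLpNorm_of_ae_le_mul' h3 2

lemma aux_conv_L2 (F : 𝓢(E2, ℂ)) (H : E2 → ℂ) (hH : MemLp H 2 volume) (M : ℝ≥0∞) (hMt : M ≠ ⊤)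
    (hM : ∀ x, ‖𝓕⁻ (F : E2 → ℂ) x‖ₑ ≤ M) :
    eLpNorm (fun ξ => ∫ η, F (ξ - η) * H η) 2 volume ≤ M * eLpNorm H 2 volume := by
  have hex : ∀ n : ℕ, ∃ G : 𝓢(E2, ℂ),
      eLpNorm (H - (G : E2 → ℂ)) 2 volume ≤ ENNReal.ofReal (1 / ((n : ℝ) + 1)) := by
    intro n
    obtain ⟨g, hg₁, hg₂, hg₃⟩ := MemLp.exist_eLpNorm_sub_le (by norm_num) (by norm_num) hH
      (ε := 1 / ((n : ℝ) + 1)) (by positivity)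
    exact ⟨hg₁.toSchwartzMap hg₂, hg₃⟩
  choose G hG using hex
  have hlim0 : Tendsto (fun n : ℕ => ENNReal.ofReal (1 / ((n : ℝ) + 1))) atTop (𝓝 0) := by
    have := ENNReal.tendsto_ofReal (tendsto_one_div_add_atTop_nhds_zero_nat (𝕜 := ℝ))
    simpa using this
  have hFs : ∀ ξ : E2, MemLp (fun η => F (ξ - η)) 2 volume := fun ξ =>
    (F.memLp 2).comp_measurePreserving (Measure.measurePreserving_sub_left volume ξ)
  have hmeas : ∀ n, AEStronglyMeasurable (fun ξ => ∫ η, F (ξ - η) * G n η) volume := by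
    intro n
    refine (AEStronglyMeasurable.integral_prod_right' (f := fun p : E2 × E2 =>
      F (p.1 - p.2) * G n p.2) ?_)
    exact Continuous.aestronglyMeasurable (by fun_prop)
  have hpt : ∀ ξ : E2, Tendsto (fun n => ∫ η, F (ξ - η) * G n η) atTop
      (𝓝 (∫ η, F (ξ - η) * H η)) := by
    intro ξ
    rw [tendsto_iff_edist_tendsto_0]
    have hb : ∀ n, edist (∫ η, F (ξ - η) * G n η) (∫ η, F (ξ - η) * H η) ≤
        eLpNorm (fun η => F (ξ - η)) 2 volume * ENNReal.ofReal (1 / ((n : ℝ) + 1)) := by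
      intro n
      have i1 : Integrable (fun η => F (ξ - η) * G n η) :=
        MemLp.integrable_mul (hFs ξ) ((G n).memLp 2)
      have i2 : Integrable (fun η => F (ξ - η) * H η) :=
        MemLp.integrable_mul (hFs ξ) hH
      rw [edist_comm, edist_eq_enorm_sub, ← integral_sub i2 i1]
      refine (enorm_integral_le_lintegral_enorm _).trans ?_
      rw [← eLpNorm_one_eq_lintegral_enorm]
      have := eLpNorm_smul_le_mul_eLpNorm (p := 2) (q := 2) (r := 1) (μ := volume)
        (hH.1.sub (G n).continuous.aestronglyMeasurable) (hFs ξ).1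
      refine le_trans (le_of_eq ?_) (this.trans (by gcongr; exact hG n))
      congr 1
      funext η
      simp [mul_sub]
    refine tendsto_of_tendsto_of_tendsto_of_le_of_le tendsto_const_nhds ?_
      (fun n => zero_le) hb
    have := ENNReal.Tendsto.const_mul (a := eLpNorm (fun η => F (ξ - η)) 2 volume) hlim0
      (Or.inr (hFs ξ).2.ne)
    simpa using this
  refine (Lp.eLpNorm_lim_le_liminf_eLpNorm hmeas _ (Eventually.of_forall hpt)).trans ?_
  have hb : ∀ n, eLpNorm (fun ξ => ∫ η, F (ξ - η) * G n η) 2 volume ≤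
      M * (eLpNorm H 2 volume + ENNReal.ofReal (1 / ((n : ℝ) + 1))) := by
    intro n
    refine (aux_conv_schwartz F (G n) M hM).trans ?_
    gcongr
    have : (G n : E2 → ℂ) = H - (H - G n) := by simp
    rw [this]
    refine (eLpNorm_sub_le hH.1 (hH.1.sub (G n).continuous.aestronglyMeasurable)
      (by norm_num)).trans ?_
    gcongr
    exact hG n
  have ht : Tendsto (fun n : ℕ => M * (eLpNorm H 2 volume + ENNReal.ofReal (1 / ((n : ℝ) + 1))))
      atTop (𝓝 (M * eLpNorm H 2 volume)) := by
    refine ENNReal.Tendsto.const_mul ?_ (Or.inr hMt)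
    simpa using hlim0.const_add (eLpNorm H 2 volume)
  rw [← ht.liminf_eq]
  exact liminf_le_liminf (Eventually.of_forall hb)

lemma aux_bump : ∃ K : NNReal, ∀ c : ℝ, 0 < c → ∃ Φ : 𝓢(E2, ℂ),
    (∀ ξ, ‖c • ξ‖ ≤ 1/4 → Φ ξ = 1) ∧ (∀ ξ, 1/2 ≤ ‖c • ξ‖ → Φ ξ = 0) ∧
    (∀ ξ, ‖1 - Φ ξ‖ ≤ 1) ∧ ∫ x, ‖𝓕 (Φ : E2 → ℂ) x‖ ≤ K := by
  let b : ContDiffBump (0 : E2) := ⟨1/4, 1/2, by norm_num, by norm_num⟩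
  let φ : E2 → ℂ := fun ξ => ((b ξ : ℝ) : ℂ)
  have hφs : HasCompactSupport φ := b.hasCompactSupport.comp_left (g := fun x : ℝ => (x : ℂ)) (by simp)
  have hφd : ContDiff ℝ (⊤ : ℕ∞) φ := Complex.ofRealCLM.contDiff.comp b.contDiff
  refine ⟨⟨∫ x, ‖𝓕 φ x‖, integral_nonneg fun _ => norm_nonneg _⟩, fun c hc => ?_⟩
  have h1 : HasCompactSupport (fun ξ => φ (c • ξ)) := hφs.comp_smul hc.ne'
  have h2 : ContDiff ℝ (⊤ : ℕ∞) (fun ξ => φ (c • ξ)) := hφd.comp (contDiff_const_smul c)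
  refine ⟨h1.toSchwartzMap h2, ?_, ?_, ?_, ?_⟩
  · intro ξ hξ
    have : b (c • ξ) = 1 := b.one_of_mem_closedBall (by simpa [b] using hξ)
    simp [φ, this]
  · intro ξ hξ
    have : b (c • ξ) = 0 := b.zero_of_le_dist (by simpa [b] using hξ)
    simp [φ, this]
  · intro ξ
    have h0 : 0 ≤ b (c • ξ) := b.nonneg
    have h1 : b (c • ξ) ≤ 1 := b.le_one
    change ‖(1 : ℂ) - ((b (c • ξ) : ℝ) : ℂ)‖ ≤ 1
    rw [← Complex.ofReal_one, ← Complex.ofReal_sub, Complex.norm_real, Real.norm_eq_abs, abs_le]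
    constructor <;> linarith
  · have hF : ∀ x : E2, 𝓕 (fun ξ => φ (c • ξ)) x = |(c ^ 2)⁻¹| • 𝓕 φ (c⁻¹ • x) := by
      intro x
      have := Measure.integral_comp_smul (volume : Measure E2)
        (fun ζ => 𝐞 (-⟪ζ, c⁻¹ • x⟫) • φ ζ) c
      rw [finrank_euclideanSpace_fin] at this
      rw [Real.fourier_eq, Real.fourier_eq, ← this]
      refine integral_congr_ae (Eventually.of_forall fun ξ => ?_)
      simp only [inner_smul_left, inner_smul_right]
      congr 3
      simp [hc.ne']
    change ∫ x, ‖𝓕 (fun ξ => φ (c • ξ)) x‖ ≤ ∫ x, ‖𝓕 φ x‖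
    simp_rw [hF, norm_smul]
    rw [integral_const_mul, Measure.integral_comp_smul volume (fun x => ‖𝓕 φ x‖) c⁻¹,
      finrank_euclideanSpace_fin]
    apply le_of_eq
    rw [smul_eq_mul, ← mul_assoc]
    have : ‖|(c ^ 2)⁻¹|‖ * |((c⁻¹) ^ 2)⁻¹| = 1 := by
      rw [Real.norm_eq_abs, abs_abs, ← abs_mul]
      rw [inv_pow, inv_inv, inv_mul_cancel₀ (by positivity), abs_one]
    rw [this, one_mul]

lemma aux_low : ∃ K : NNReal, ∀ c : ℝ, 0 < c → ∃ Φ : 𝓢(E2, ℂ),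
    (∀ ξ, ‖c • ξ‖ ≤ 1/4 → Φ ξ = 1) ∧ (∀ ξ, 1/2 ≤ ‖c • ξ‖ → Φ ξ = 0) ∧
    (∀ ξ, ‖1 - Φ ξ‖ ≤ 1) ∧ ∀ (f : 𝓢(E2, ℂ)) (B : NNReal), (∀ᵐ x, ‖f x‖ ≤ B) →
      ∀ x, ‖𝓕⁻ (fun ξ => Φ ξ * 𝓕 (f : E2 → ℂ) ξ) x‖ₑ ≤ (K * B : NNReal) := by
  obtain ⟨K, hK⟩ := aux_bump
  refine ⟨K, fun c hc => ?_⟩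
  obtain ⟨Φ, h1, h2, h3, h4⟩ := hK c hc
  refine ⟨Φ, h1, h2, h3, fun f B hB x => ?_⟩
  rw [aux_conv_fourierInv Φ.integrable f.integrable]
  have hi : Integrable (𝓕 (Φ : E2 → ℂ)) := by
    rw [← SchwartzMap.fourier_coe]; exact SchwartzMap.integrable _
  have hi2 : Integrable (fun y => ‖𝓕 (Φ : E2 → ℂ) (y - x)‖ * B) :=
    ((hi.comp_sub_right x).norm).mul_const _
  have : ‖∫ y, 𝓕 (Φ : E2 → ℂ) (y - x) * f y‖ ≤ K * B := by
    calc _ ≤ ∫ y, ‖𝓕 (Φ : E2 → ℂ) (y - x)‖ * B := by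
          refine norm_integral_le_of_norm_le hi2 ?_
          filter_upwards [hB] with y hy
          rw [norm_mul]
          gcongr
      _ = (∫ y, ‖𝓕 (Φ : E2 → ℂ) y‖) * B := by
          rw [integral_mul_const, integral_sub_right_eq_self (fun y => ‖𝓕 (Φ : E2 → ℂ) y‖)]
      _ ≤ _ := by gcongr
  rw [← ofReal_norm, ← ENNReal.ofReal_coe_nnreal]
  exact ENNReal.ofReal_le_ofReal (by simpa using this)

lemma aux_cs {p q : E2 → ℝ≥0∞} (hp : Measurable p) (hq : Measurable q) :
    (∫⁻ x, p x * q x) ^ 2 ≤ (∫⁻ x, (p x) ^ 2) * ∫⁻ x, (q x) ^ 2 := by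
  have h := ENNReal.lintegral_mul_le_Lp_mul_Lq volume Real.HolderConjugate.two_two
    hp.aemeasurable hq.aemeasurable
  calc _ ≤ ((∫⁻ a, p a ^ (2:ℝ)) ^ (1 / 2 : ℝ) * (∫⁻ a, q a ^ (2:ℝ)) ^ (1 / 2 : ℝ)) ^ 2 := by
        gcongr
        exact h
    _ = _ := by
        rw [mul_pow, ← ENNReal.rpow_natCast, ← ENNReal.rpow_natCast, ← ENNReal.rpow_mul,
          ← ENNReal.rpow_mul]
        norm_num

lemma aux_young {p q : E2 → ℝ≥0∞} (hp : Measurable p) (hq : Measurable q) :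
    ∫⁻ ξ, (∫⁻ η, p (ξ - η) * q η) ^ 2 ≤ (∫⁻ η, q η) ^ 2 * ∫⁻ ξ, (p ξ) ^ 2 := by
  have h1 : ∀ ξ, (∫⁻ η, p (ξ - η) * q η) ^ 2 ≤ (∫⁻ η, (p (ξ - η)) ^ 2 * q η) * ∫⁻ η, q η := by
    intro ξ
    have hm : Measurable (fun η => p (ξ - η)) := hp.comp (measurable_const.sub measurable_id)
    have := aux_cs (p := fun η => p (ξ - η) * (q η) ^ (1/2 : ℝ)) (q := fun η => (q η) ^ (1/2 : ℝ))
      (hm.mul (hq.pow_const _)) (hq.pow_const _)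
    have hs : ∀ a : ℝ≥0∞, a ^ (1/2 : ℝ) * a ^ (1/2 : ℝ) = a := fun a => by
      rw [← ENNReal.rpow_add_of_nonneg _ _ (by norm_num) (by norm_num)]; norm_num
    simp only [mul_assoc, sq, hs] at this
    simp only [sq, mul_assoc] at this ⊢
    refine this.trans (le_of_eq ?_)
    congr 1
    refine lintegral_congr fun η => ?_
    rw [mul_left_comm (q η ^ (1/2 : ℝ)), hs]
  calc _ ≤ ∫⁻ ξ, (∫⁻ η, (p (ξ - η)) ^ 2 * q η) * ∫⁻ η, q η := lintegral_mono h1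
    _ = (∫⁻ ξ, ∫⁻ η, (p (ξ - η)) ^ 2 * q η) * ∫⁻ η, q η := by
        rw [lintegral_mul_const]
        exact Measurable.lintegral_prod_right' (f := fun z : E2 × E2 => (p (z.1 - z.2)) ^ 2 * q z.2)
          (by fun_prop)
    _ = (∫⁻ η, ∫⁻ ξ, (p (ξ - η)) ^ 2 * q η) * ∫⁻ η, q η := by
        rw [lintegral_lintegral_swap]
        exact Measurable.aemeasurable (by fun_prop)
    _ = (∫⁻ η, (∫⁻ ξ, (p ξ) ^ 2) * q η) * ∫⁻ η, q η := by
        congr 1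
        refine lintegral_congr fun η => ?_
        rw [lintegral_mul_const _ (by fun_prop),
          lintegral_sub_right_eq_self (fun ξ => (p ξ) ^ 2)]
    _ = _ := by
        rw [lintegral_const_mul _ hq]; ring

lemma aux_sq (a b : ℝ≥0∞) : (a + b) ^ 2 ≤ 4 * a ^ 2 + 4 * b ^ 2 := by
  rcases le_total a b with h | h
  · calc (a + b) ^ 2 ≤ (b + b) ^ 2 := by gcongr
      _ = 4 * b ^ 2 := by ring
      _ ≤ _ := le_add_self
  · calc (a + b) ^ 2 ≤ (a + a) ^ 2 := by gcongr
      _ = 4 * a ^ 2 := by ring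
      _ ≤ _ := le_self_add

lemma aux_eLp (f : E2 → ℂ) : (eLpNorm f 2 volume) ^ 2 = ∫⁻ x, ‖f x‖ₑ ^ 2 := by
  have := eLpNorm_nnreal_pow_eq_lintegral (μ := volume) (f := f) (p := 2) (by norm_num)
  simpa using this

/-- Dyadic annulus. -/
def ann (m : ℤ) : Set E2 := {ξ | (2:ℝ) ^ m ≤ ‖ξ‖ ∧ ‖ξ‖ < (2:ℝ) ^ (m + 1)}

lemma ann_meas (m : ℤ) : MeasurableSet (ann m) :=
  (measurableSet_le measurable_const measurable_norm).inter
    (measurableSet_lt measurable_norm measurable_const)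

lemma ann_disj : Pairwise (Function.onFun Disjoint ann) := by
  have key : ∀ m n : ℤ, m < n → Disjoint (ann m) (ann n) := by
    intro m n hmn
    rw [Set.disjoint_left]
    rintro ξ ⟨_, h1⟩ ⟨h2, _⟩
    have : (2:ℝ) ^ (m + 1) ≤ 2 ^ n := zpow_le_zpow_right₀ (by norm_num) (by omega)
    linarith
  intro m n hmn
  rcases lt_or_gt_of_ne hmn with h | h
  · exact key m n h
  · exact (key n m h).symm

lemma ann_cover (g : E2 → ℝ≥0∞) : ∫⁻ ξ, g ξ = ∑' m : ℤ, ∫⁻ ξ in ann m, g ξ := by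
  rw [← lintegral_iUnion ann_meas ann_disj]
  have h : (⋃ m, ann m) =ᵐ[volume] Set.univ := by
    have h0 : ∀ᵐ ξ : E2, ξ ≠ 0 := by
      simp [ae_iff]
    rw [eventuallyEq_univ]
    filter_upwards [h0] with ξ hξ
    obtain ⟨n, hn⟩ := exists_mem_Ico_zpow (norm_pos_iff.2 hξ) (one_lt_two : (1:ℝ) < 2)
    exact Set.mem_iUnion.2 ⟨n, hn⟩
  rw [setLIntegral_congr h, setLIntegral_univ]

lemma aux_core_piece (σ : ℝ) (hσ : 0 < σ) (K : NNReal) (m : ℤ) (Φ : 𝓢(E2, ℂ))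
    (h1 : ∀ ξ, ‖((2:ℝ) ^ (-m)) • ξ‖ ≤ 1/4 → Φ ξ = 1)
    (h2 : ∀ ξ, 1/2 ≤ ‖((2:ℝ) ^ (-m)) • ξ‖ → Φ ξ = 0)
    (h3 : ∀ ξ, ‖1 - Φ ξ‖ ≤ 1)
    (f : 𝓢(E2, ℂ)) (B : NNReal)
    (h4 : ∀ x, ‖𝓕⁻ (fun ξ => Φ ξ * 𝓕 (f : E2 → ℂ) ξ) x‖ₑ ≤ (K * B : NNReal))
    (h : E2 → ℂ) (hm : Measurable h) (hh2 : MemLp h 2 volume) :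
    ∫⁻ ξ in ann m, (‖ξ‖ₑ ^ σ * ‖∫ η, 𝓕 (f : E2 → ℂ) (ξ - η) * h η‖ₑ) ^ 2 ≤
      4 * (4 ^ σ) ^ 2 * (K * B) ^ 2 * ((∫⁻ ξ in ann (m - 1), (‖ξ‖ₑ ^ σ * ‖h ξ‖ₑ) ^ 2)
        + (∫⁻ ξ in ann m, (‖ξ‖ₑ ^ σ * ‖h ξ‖ₑ) ^ 2)
        + (∫⁻ ξ in ann (m + 1), (‖ξ‖ₑ ^ σ * ‖h ξ‖ₑ) ^ 2))
      + 4 * (8 ^ σ) ^ 2 * ∫⁻ ξ in ann m,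
          (∫⁻ η, (‖ξ - η‖ₑ ^ σ * ‖𝓕 (f : E2 → ℂ) (ξ - η)‖ₑ) * ‖h η‖ₑ) ^ 2 := by
  have hpos : (0:ℝ) < 2 ^ m := by positivity
  have hz1 : (2:ℝ) ^ (m + 1) = 2 * 2 ^ m := by rw [zpow_add_one₀ (by norm_num)]; ring
  have hz2 : (2:ℝ) ^ (m + 1 + 1) = 4 * 2 ^ m := by rw [zpow_add_one₀ (by norm_num), hz1]; ring
  have hz3 : (2:ℝ) ^ (m - 1) = 2 ^ m / 2 := by rw [zpow_sub_one₀ (by norm_num)]; ring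
  have hns : ∀ ξ : E2, ‖((2:ℝ) ^ (-m)) • ξ‖ = ‖ξ‖ / 2 ^ m := by
    intro ξ
    rw [norm_smul, zpow_neg, Real.norm_eq_abs, abs_of_pos (by positivity)]
    field_simp
  set T : Set E2 := ann (m - 1) ∪ ann m ∪ ann (m + 1) with hT
  have hTm : MeasurableSet T := ((ann_meas _).union (ann_meas _)).union (ann_meas _)
  have hTmem : ∀ η : E2, (2:ℝ) ^ m / 2 ≤ ‖η‖ → ‖η‖ < 4 * 2 ^ m → η ∈ T := by
    intro η ha hb
    simp only [hT, ann, Set.mem_union, Set.mem_ofPred_eq, sub_add_cancel, hz1, hz2, hz3]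
    grind
  have hTle : ∀ η ∈ T, (2:ℝ) ^ m / 2 ≤ ‖η‖ := by
    intro η hη
    simp only [hT, ann, Set.mem_union, Set.mem_ofPred_eq, sub_add_cancel, hz1, hz2, hz3] at hη
    rcases hη with (hη | hη) | hη <;> linarith [hη.1]
  let F : 𝓢(E2, ℂ) := SchwartzMap.smulLeftCLM ℂ (Φ : E2 → ℂ) (𝓕 f)
  have hF : ∀ ξ, F ξ = Φ ξ * 𝓕 (f : E2 → ℂ) ξ := by
    intro ξ
    simp only [F]
    rw [SchwartzMap.smulLeftCLM_apply_apply (SchwartzMap.hasTemperateGrowth _), smul_eq_mul,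
      SchwartzMap.fourier_coe]
  have hFe : (F : E2 → ℂ) = fun ξ => Φ ξ * 𝓕 (f : E2 → ℂ) ξ := funext hF
  let H : E2 → ℂ := T.indicator h
  have hH : MemLp H 2 volume := hh2.indicator hTm
  have hfm : ∀ ξ : E2, MemLp (fun η => 𝓕 (f : E2 → ℂ) (ξ - η)) 2 volume := fun ξ => by
    rw [← SchwartzMap.fourier_coe]
    exact ((𝓕 f : 𝓢(E2, ℂ)).memLp 2 volume).comp_measurePreserving
      (Measure.measurePreserving_sub_left volume ξ)
  have hFm : ∀ ξ : E2, MemLp (fun η => F (ξ - η)) 2 volume := fun ξ =>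
    (F.memLp 2 volume).comp_measurePreserving (Measure.measurePreserving_sub_left volume ξ)
  set D : E2 → ℝ≥0∞ := fun ξ =>
    ∫⁻ η, (‖ξ - η‖ₑ ^ σ * ‖𝓕 (f : E2 → ℂ) (ξ - η)‖ₑ) * ‖h η‖ₑ with hD
  set G : E2 → ℂ := fun ξ => ∫ η, F (ξ - η) * H η with hG
  have hpt : ∀ ξ ∈ ann m, (‖ξ‖ₑ ^ σ * ‖∫ η, 𝓕 (f : E2 → ℂ) (ξ - η) * h η‖ₑ) ^ 2 ≤
      4 * ((ENNReal.ofReal (2 * 2 ^ m)) ^ σ * ‖G ξ‖ₑ) ^ 2 + 4 * (8 ^ σ * D ξ) ^ 2 := by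
    intro ξ hξ
    have hξ1 := hξ.1
    have hξ2 := hξ.2
    rw [hz1] at hξ2
    have hsplit : ∫ η, 𝓕 (f : E2 → ℂ) (ξ - η) * h η = G ξ +
        ∫ η, (1 - Φ (ξ - η)) * 𝓕 (f : E2 → ℂ) (ξ - η) * h η := by
      have e1 : G ξ = ∫ η, F (ξ - η) * h η := by
        refine integral_congr_ae (Eventually.of_forall fun η => ?_)
        by_cases hη : η ∈ T
        · simp [H, hη]
        · have : Φ (ξ - η) = 0 := by
            apply h2
            rw [hns]
            by_contra hcon
            push Not at hcon
            rw [div_lt_iff₀ hpos] at hcon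
            apply hη
            have t1 : ‖ξ‖ ≤ ‖ξ - η‖ + ‖η‖ := by simpa using norm_add_le (ξ - η) η
            have t2 : ‖η‖ ≤ ‖ξ‖ + ‖ξ - η‖ := by simpa using norm_sub_le ξ (ξ - η)
            exact hTmem η (by linarith) (by linarith)
          simp [hF, this]
      have i1 : Integrable (fun η => 𝓕 (f : E2 → ℂ) (ξ - η) * h η) :=
        MemLp.integrable_mul (hfm ξ) hh2
      have i2 : Integrable (fun η => F (ξ - η) * h η) := MemLp.integrable_mul (hFm ξ) hh2
      rw [e1]
      have : (fun η => (1 - Φ (ξ - η)) * 𝓕 (f : E2 → ℂ) (ξ - η) * h η) =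
          fun η => 𝓕 (f : E2 → ℂ) (ξ - η) * h η - F (ξ - η) * h η := by
        funext η; rw [hF]; ring
      rw [this, integral_sub i1 i2]
      ring
    rw [hsplit]
    refine le_trans ?_ (aux_sq _ _)
    gcongr ?_ ^ 2
    refine (mul_le_mul_right (enorm_add_le _ _) _).trans ?_
    rw [mul_add]
    refine add_le_add ?_ ?_
    · gcongr
      rw [← ofReal_norm]
      exact ENNReal.ofReal_le_ofReal hξ2.le
    · refine (mul_le_mul_right (enorm_integral_le_lintegral_enorm _) _).trans ?_
      rw [← lintegral_const_mul' _ _ (by finiteness), hD]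
      simp only
      rw [← lintegral_const_mul' _ _ (by finiteness)]
      refine lintegral_mono fun η => ?_
      simp only [enorm_mul]
      by_cases hη : Φ (ξ - η) = 1
      · simp [hη]
      · have hlt : 1/4 < ‖ξ - η‖ / 2 ^ m := by
          by_contra hcon
          push Not at hcon
          exact hη (h1 _ (by rw [hns]; exact hcon))
        rw [lt_div_iff₀ hpos] at hlt
        have hle : ‖ξ‖ₑ ≤ 8 * ‖ξ - η‖ₑ := by
          rw [← ofReal_norm, ← ofReal_norm, ← ENNReal.ofReal_ofNat 8,
            ← ENNReal.ofReal_mul (by norm_num)]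
          exact ENNReal.ofReal_le_ofReal (by linarith)
        have hle2 : ‖1 - Φ (ξ - η)‖ₑ ≤ 1 := by
          rw [← ofReal_norm]
          simpa using ENNReal.ofReal_le_ofReal (h3 (ξ - η))
        calc ‖ξ‖ₑ ^ σ * (‖1 - Φ (ξ - η)‖ₑ * ‖𝓕 (f : E2 → ℂ) (ξ - η)‖ₑ * ‖h η‖ₑ)
            ≤ (8 * ‖ξ - η‖ₑ) ^ σ * (1 * ‖𝓕 (f : E2 → ℂ) (ξ - η)‖ₑ * ‖h η‖ₑ) := by gcongr
          _ = _ := by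
            rw [ENNReal.mul_rpow_of_nonneg _ _ hσ.le]; ring
  have hDm : Measurable D := by
    have hfc : Continuous (𝓕 (f : E2 → ℂ)) := by
      rw [← SchwartzMap.fourier_coe]; exact SchwartzMap.continuous _
    have : Measurable (fun z : E2 × E2 =>
        (‖z.1 - z.2‖ₑ ^ σ * ‖𝓕 (f : E2 → ℂ) (z.1 - z.2)‖ₑ) * ‖h z.2‖ₑ) := by
      have := hfc.measurable
      fun_prop
    exact this.lintegral_prod_right'
  have hGb : ∫⁻ ξ, ‖G ξ‖ₑ ^ 2 ≤ (K * B) ^ 2 * ∫⁻ ξ in T, ‖h ξ‖ₑ ^ 2 := by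
    have := aux_conv_L2 F H hH ((K * B : NNReal) : ℝ≥0∞) (by finiteness) (by rw [hFe]; exact h4)
    have h5 : ∫⁻ ξ in T, ‖h ξ‖ₑ ^ 2 = (eLpNorm H 2 volume) ^ 2 := by
      rw [aux_eLp, ← lintegral_indicator hTm]
      refine lintegral_congr fun x => ?_
      by_cases hx : x ∈ T <;> simp [H, hx]
    rw [h5, ← aux_eLp, ← mul_pow]
    gcongr
    simpa using this
  have hTb : (ENNReal.ofReal (2 * 2 ^ m) ^ σ) ^ 2 * ∫⁻ ξ in T, ‖h ξ‖ₑ ^ 2 ≤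
      (4 ^ σ) ^ 2 * ∫⁻ ξ in T, (‖ξ‖ₑ ^ σ * ‖h ξ‖ₑ) ^ 2 := by
    rw [← lintegral_const_mul' _ _ (by finiteness), ← lintegral_const_mul' _ _ (by finiteness)]
    refine setLIntegral_mono' hTm fun ξ hξ => ?_
    rw [← mul_pow, ← mul_pow, ← mul_assoc, ← ENNReal.mul_rpow_of_nonneg _ _ hσ.le]
    gcongr
    rw [← ofReal_norm, ← ENNReal.ofReal_ofNat 4, ← ENNReal.ofReal_mul (by norm_num)]
    exact ENNReal.ofReal_le_ofReal (by linarith [hTle ξ hξ])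
  have hTu : ∫⁻ ξ in T, (‖ξ‖ₑ ^ σ * ‖h ξ‖ₑ) ^ 2 ≤
      (∫⁻ ξ in ann (m - 1), (‖ξ‖ₑ ^ σ * ‖h ξ‖ₑ) ^ 2)
        + (∫⁻ ξ in ann m, (‖ξ‖ₑ ^ σ * ‖h ξ‖ₑ) ^ 2)
        + (∫⁻ ξ in ann (m + 1), (‖ξ‖ₑ ^ σ * ‖h ξ‖ₑ) ^ 2) := by
    refine (lintegral_union_le _ _ _).trans ?_
    gcongr
    exact lintegral_union_le _ _ _
  calc _ ≤ ∫⁻ ξ in ann m, (4 * ((ENNReal.ofReal (2 * 2 ^ m)) ^ σ * ‖G ξ‖ₑ) ^ 2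
          + 4 * (8 ^ σ * D ξ) ^ 2) := setLIntegral_mono' (ann_meas m) hpt
    _ = (∫⁻ ξ in ann m, 4 * ((ENNReal.ofReal (2 * 2 ^ m)) ^ σ * ‖G ξ‖ₑ) ^ 2)
          + ∫⁻ ξ in ann m, 4 * (8 ^ σ * D ξ) ^ 2 :=
        lintegral_add_right _ (by fun_prop)
    _ ≤ _ := by
      refine add_le_add ?_ ?_
      · simp only [mul_pow]
        rw [lintegral_const_mul' _ _ (by finiteness), lintegral_const_mul' _ _ (by finiteness)]
        calc _ ≤ 4 * ((ENNReal.ofReal (2 * 2 ^ m) ^ σ) ^ 2 *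
              ((K * B) ^ 2 * ∫⁻ ξ in T, ‖h ξ‖ₑ ^ 2)) := by
              gcongr
              exact (setLIntegral_le_lintegral _ _).trans hGb
          _ = 4 * (K * B) ^ 2 * ((ENNReal.ofReal (2 * 2 ^ m) ^ σ) ^ 2 *
              (∫⁻ ξ in T, ‖h ξ‖ₑ ^ 2)) := by ring
          _ ≤ 4 * (K * B) ^ 2 * ((4 ^ σ) ^ 2 * ((∫⁻ ξ in ann (m - 1), (‖ξ‖ₑ ^ σ * ‖h ξ‖ₑ) ^ 2)
        + (∫⁻ ξ in ann m, (‖ξ‖ₑ ^ σ * ‖h ξ‖ₑ) ^ 2)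
        + (∫⁻ ξ in ann (m + 1), (‖ξ‖ₑ ^ σ * ‖h ξ‖ₑ) ^ 2))) := by
              exact mul_le_mul_right (hTb.trans (mul_le_mul_right hTu _)) _
          _ = _ := by simp only [mul_pow]; ring
      · simp only [mul_pow]
        rw [lintegral_const_mul' _ _ (by finiteness), lintegral_const_mul' _ _ (by finiteness),
          mul_assoc]

lemma aux_core (σ : ℝ) (hσ : 0 < σ) : ∃ C : NNReal, ∀ (f : 𝓢(E2, ℂ)) (B : NNReal),
    (∀ᵐ x, ‖f x‖ ≤ B) → ∀ h : E2 → ℂ, Measurable h → MemLp h 2 volume →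
    ∫⁻ ξ, (‖ξ‖ₑ ^ σ * ‖∫ η, 𝓕 (f : E2 → ℂ) (ξ - η) * h η‖ₑ) ^ 2 ≤
      C * ((B : ℝ≥0∞) ^ 2 * (∫⁻ ξ, (‖ξ‖ₑ ^ σ * ‖h ξ‖ₑ) ^ 2)
      + (∫⁻ ξ, ‖h ξ‖ₑ) ^ 2 * ∫⁻ ξ, (‖ξ‖ₑ ^ σ * ‖𝓕 (f : E2 → ℂ) ξ‖ₑ) ^ 2) := by
  obtain ⟨K, hK⟩ := aux_low
  obtain ⟨C, hC⟩ : ∃ C : NNReal, (C : ℝ≥0∞) =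
      12 * (4 ^ σ) ^ 2 * K ^ 2 + 4 * (8 ^ σ) ^ 2 := by
    refine ⟨(12 * (4 ^ σ) ^ 2 * K ^ 2 + 4 * (8 ^ σ) ^ 2 : ℝ≥0∞).toNNReal, ?_⟩
    exact ENNReal.coe_toNNReal (by finiteness)
  refine ⟨C, fun f B hB h hm hh2 => ?_⟩
  set a : ℤ → ℝ≥0∞ := fun m => ∫⁻ ξ in ann m, (‖ξ‖ₑ ^ σ * ‖h ξ‖ₑ) ^ 2 with ha
  set d : ℤ → ℝ≥0∞ := fun m => ∫⁻ ξ in ann m,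
          (∫⁻ η, (‖ξ - η‖ₑ ^ σ * ‖𝓕 (f : E2 → ℂ) (ξ - η)‖ₑ) * ‖h η‖ₑ) ^ 2 with hd
  have hfc : Continuous (𝓕 (f : E2 → ℂ)) := by
    rw [← SchwartzMap.fourier_coe]; exact SchwartzMap.continuous _
  have hy := aux_young (p := fun ξ => ‖ξ‖ₑ ^ σ * ‖𝓕 (f : E2 → ℂ) ξ‖ₑ) (q := fun ξ => ‖h ξ‖ₑ)
    (by have := hfc.measurable; fun_prop) (by fun_prop)
  have hpiece : ∀ m : ℤ,
      ∫⁻ ξ in ann m, (‖ξ‖ₑ ^ σ * ‖∫ η, 𝓕 (f : E2 → ℂ) (ξ - η) * h η‖ₑ) ^ 2 ≤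
      4 * (4 ^ σ) ^ 2 * (K * B) ^ 2 * (a (m - 1) + a m + a (m + 1)) + 4 * (8 ^ σ) ^ 2 * d m := by
    intro m
    obtain ⟨Φ, h1, h2, h3, h4⟩ := hK ((2:ℝ) ^ (-m)) (by positivity)
    exact aux_core_piece σ hσ K m Φ h1 h2 h3 f B (h4 f B hB) h hm hh2
  have s1 : ∑' m, a (m - 1) = ∑' m, a m := (Equiv.subRight (1:ℤ)).tsum_eq a
  have s2 : ∑' m, a (m + 1) = ∑' m, a m := (Equiv.addRight (1:ℤ)).tsum_eq a
  rw [ann_cover]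
  calc _ ≤ ∑' m, (4 * (4 ^ σ) ^ 2 * (K * B) ^ 2 * (a (m - 1) + a m + a (m + 1))
        + 4 * (8 ^ σ) ^ 2 * d m) := ENNReal.tsum_le_tsum hpiece
    _ = 4 * (4 ^ σ) ^ 2 * (K * B) ^ 2 * (3 * ∑' m, a m) + 4 * (8 ^ σ) ^ 2 * ∑' m, d m := by
        rw [ENNReal.tsum_add, ENNReal.tsum_mul_left, ENNReal.tsum_mul_left, ENNReal.tsum_add,
          ENNReal.tsum_add, s1, s2]
        ring
    _ = (12 * (4 ^ σ) ^ 2 * K ^ 2) * (B ^ 2 * ∫⁻ ξ, (‖ξ‖ₑ ^ σ * ‖h ξ‖ₑ) ^ 2) +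
        4 * (8 ^ σ) ^ 2 * ∫⁻ ξ,
          (∫⁻ η, (‖ξ - η‖ₑ ^ σ * ‖𝓕 (f : E2 → ℂ) (ξ - η)‖ₑ) * ‖h η‖ₑ) ^ 2 := by
        rw [ha, hd]
        simp only
        rw [← ann_cover, ← ann_cover]
        ring
    _ ≤ C * (B ^ 2 * ∫⁻ ξ, (‖ξ‖ₑ ^ σ * ‖h ξ‖ₑ) ^ 2) + C *
        ((∫⁻ ξ, ‖h ξ‖ₑ) ^ 2 * ∫⁻ ξ, (‖ξ‖ₑ ^ σ * ‖𝓕 (f : E2 → ℂ) ξ‖ₑ) ^ 2) := by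
        refine add_le_add (mul_le_mul_left ?_ _) (mul_le_mul' ?_ hy)
        · rw [hC]; exact le_self_add
        · rw [hC]; exact le_add_self
    _ = _ := by ring

def hd (σ : ℝ) (h : E2 → ℂ) : ℝ≥0∞ := eLpNorm (fun ξ : E2 => ‖ξ‖ ^ σ * ‖h ξ‖) 2 volume

lemma hd_sq (σ : ℝ) (hσ : 0 ≤ σ) (h : E2 → ℂ) :
    hd σ h ^ 2 = ∫⁻ ξ, (‖ξ‖ₑ ^ σ * ‖h ξ‖ₑ)^2 := by
  have := eLpNorm_nnreal_pow_eq_lintegral (f := fun ξ : E2 => ‖ξ‖ ^ σ * ‖h ξ‖) (μ := volume)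
    (p := 2) (by norm_num)
  unfold hd
  have h2 : eLpNorm (fun ξ : E2 => ‖ξ‖ ^ σ * ‖h ξ‖) 2 volume ^ 2
      = eLpNorm (fun ξ : E2 => ‖ξ‖ ^ σ * ‖h ξ‖) ((2 : NNReal) : ℝ≥0∞) volume ^ ((2 : NNReal) : ℝ) := by
    norm_num
  rw [h2, this]
  refine lintegral_congr fun ξ => ?_
  rw [enorm_mul, Real.enorm_rpow_of_nonneg (norm_nonneg _) hσ, enorm_norm, enorm_norm]
  norm_num

lemma hd_core (σ : ℝ) (hσ : 0 < σ) : ∃ C : NNReal, ∀ (f : 𝓢(E2, ℂ)) (B : NNReal),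
    (∀ᵐ x, ‖f x‖ ≤ B) → ∀ h : E2 → ℂ, Measurable h → MemLp h 2 volume →
    hd σ (fun ξ => ∫ η, 𝓕 (f : E2 → ℂ) (ξ - η) * h η) ≤
      C * (B * hd σ h + (∫⁻ ξ, ‖h ξ‖ₑ) * hd σ (𝓕 (f : E2 → ℂ))) := by
  obtain ⟨C, hC⟩ := aux_core σ hσ
  refine ⟨C + 1, fun f B hB h hm hL => ?_⟩
  have := hC f B hB h hm hL
  rw [← hd_sq σ hσ.le, ← hd_sq σ hσ.le, ← hd_sq σ hσ.le] at this
  have key : ∀ X C a b c d : ℝ≥0∞, X ^ 2 ≤ C * (a ^ 2 * b ^ 2 + c ^ 2 * d ^ 2) →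
      X ≤ (C + 1) * (a * b + c * d) := by
    intro X C a b c d hX
    rw [← ENNReal.pow_le_pow_left_iff (n := 2) (by norm_num)]
    refine hX.trans ?_
    rw [mul_pow]
    refine mul_le_mul' ?_ ?_
    · calc C ≤ C * 1 + 1 * 1 + (C * C + C) := by
            rw [mul_one, add_assoc]; exact le_self_add
        _ = _ := by ring
    · calc a ^ 2 * b ^ 2 + c ^ 2 * d ^ 2 ≤ a ^ 2 * b ^ 2 + c ^ 2 * d ^ 2 + 2 * a * b * c * d := le_self_add
        _ = _ := by ring
  have := key _ _ _ _ _ _ this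
  simpa using this

lemma aux_L1 (ι : ℝ) (hι : 0 < ι) : ∃ C : NNReal, ∀ h : E2 → ℂ, Measurable h →
    ∫⁻ ξ, ‖h ξ‖ₑ ≤ C * (eLpNorm h 2 volume + hd (1 + ι) h) := by
  set r := 1 + ι with hr
  have hintg : Integrable (fun x : E2 => (1 + ‖x‖) ^ (-(2 * r))) volume := by
    apply integrable_one_add_norm
    rw [finrank_euclideanSpace_fin]; push_cast; linarith
  set K : ℝ≥0∞ := ∫⁻ x : E2, ENNReal.ofReal ((1 + ‖x‖) ^ (-(2 * r))) with hK
  have hKf : K ≠ ⊤ := by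
    have := hintg.lintegral_lt_top
    exact this.ne
  have hD : ∃ D : ℝ≥0∞, D ≠ ⊤ ∧ ∀ a : ℝ≥0∞, ((1 + a) ^ r) ≤ D * (1 + a ^ r) := by
    refine ⟨2 ^ (r - 1), by finiteness, fun a => ?_⟩
    have := ENNReal.rpow_add_le_mul_rpow_add_rpow 1 a (p := r) (by linarith)
    simpa using this
  obtain ⟨D, hDf, hD⟩ := hD
  refine ⟨((K + 1) * (4 * D ^ 2 + 1)).toNNReal, fun h hm => ?_⟩
  rw [ENNReal.coe_toNNReal (by finiteness)]
  have hcs := aux_cs (p := fun x : E2 => ENNReal.ofReal ((1 + ‖x‖) ^ (-r)))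
    (q := fun x : E2 => (1 + ‖x‖ₑ) ^ r * ‖h x‖ₑ) (by fun_prop) (by fun_prop)
  have e1 : ∀ x : E2, ENNReal.ofReal ((1 + ‖x‖) ^ (-r)) * ((1 + ‖x‖ₑ) ^ r * ‖h x‖ₑ) = ‖h x‖ₑ := by
    intro x
    have hx : 0 < 1 + ‖x‖ := by positivity
    have : (1 + ‖x‖ₑ) ^ r = ENNReal.ofReal ((1 + ‖x‖) ^ r) := by
      rw [← ENNReal.ofReal_rpow_of_pos hx, ENNReal.ofReal_add zero_le_one (norm_nonneg _), ofReal_norm]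
      simp
    rw [this, ← mul_assoc, ← ENNReal.ofReal_mul (by positivity), ← Real.rpow_add hx]
    simp
  have e2 : ∀ x : E2, ENNReal.ofReal ((1 + ‖x‖) ^ (-r)) ^ 2 = ENNReal.ofReal ((1 + ‖x‖) ^ (-(2 * r))) := by
    intro x
    have hx : 0 < 1 + ‖x‖ := by positivity
    rw [← ENNReal.ofReal_pow (by positivity), ← Real.rpow_natCast, ← Real.rpow_mul hx.le]
    congr 2; push_cast; ring
  simp only [e1, e2] at hcs
  rw [← hK] at hcs
  have h3 : ∫⁻ x : E2, ((1 + ‖x‖ₑ) ^ r * ‖h x‖ₑ) ^ 2 ≤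
      D ^ 2 * (4 * eLpNorm h 2 volume ^ 2 + 4 * hd r h ^ 2) := by
    rw [aux_eLp, hd_sq r (by linarith), ← lintegral_const_mul _ (by fun_prop),
      ← lintegral_const_mul _ (by fun_prop), ← lintegral_add_left (by fun_prop),
      ← lintegral_const_mul _ (by fun_prop)]
    refine lintegral_mono fun x => ?_
    calc ((1 + ‖x‖ₑ) ^ r * ‖h x‖ₑ) ^ 2 ≤ (D * (1 + ‖x‖ₑ ^ r) * ‖h x‖ₑ) ^ 2 := by
          gcongr; exact hD _
      _ = D ^ 2 * (‖h x‖ₑ + ‖x‖ₑ ^ r * ‖h x‖ₑ) ^ 2 := by ring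
      _ ≤ _ := by gcongr; exact aux_sq _ _
  have h4 := hcs.trans (mul_le_mul_right h3 K)
  rw [← ENNReal.pow_le_pow_left_iff (n := 2) (by norm_num)]
  refine h4.trans ?_
  generalize eLpNorm h 2 volume = a
  generalize hd r h = b
  calc K * (D ^ 2 * (4 * a ^ 2 + 4 * b ^ 2)) = K * ((4 * D ^ 2) * (a ^ 2 + b ^ 2)) := by ring
    _ ≤ (K + 1) ^ 2 * ((4 * D ^ 2 + 1) ^ 2 * (a + b) ^ 2) := by
        have aux : ∀ C : ℝ≥0∞, C ≤ (C + 1) ^ 2 := fun C => by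
          calc C ≤ C + (C * C + C + 1) := le_self_add
            _ = _ := by ring
        gcongr
        · exact aux _
        · exact aux _
        · calc a ^ 2 + b ^ 2 ≤ a ^ 2 + b ^ 2 + 2 * a * b := le_self_add
            _ = _ := by ring
    _ = _ := by ring

open scoped LineDeriv

/-- complexified component of a Schwartz vector field -/
def vcmp (j : Fin 2) (u : 𝓢(E2, E2)) : 𝓢(E2, ℂ) :=
  SchwartzMap.postcompCLM (𝕜 := ℝ) (Complex.ofRealCLM ∘L (EuclideanSpace.proj j : E2 →L[ℝ] ℝ)) u

lemma vcmp_apply (j : Fin 2) (u : 𝓢(E2, E2)) (x : E2) : vcmp j u x = ((u x j : ℝ) : ℂ) := rfl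

lemma vcmp_coe (j : Fin 2) (u : 𝓢(E2, E2)) : (vcmp j u : E2 → ℂ) = fun x => ((u x j : ℝ) : ℂ) := rfl

/-- partial derivative of a component -/
def dcmp (i j : Fin 2) (v : 𝓢(E2, E2)) : 𝓢(E2, ℂ) :=
  ∂_{(EuclideanSpace.single j (1 : ℝ) : E2)} (vcmp i v)

lemma comp_fderiv (i : Fin 2) (v : 𝓢(E2, E2)) (x e : E2) :
    fderiv ℝ (fun y => v y i) x e = (fderiv ℝ (fun y => v y) x e) i := by
  have h1 : HasFDerivAt (fun y => v y) (fderiv ℝ (fun y => v y) x) x := v.differentiableAt.hasFDerivAt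
  have h2 := ((EuclideanSpace.proj i : E2 →L[ℝ] ℝ).hasFDerivAt).comp x h1
  have h3 : fderiv ℝ (fun y => v y i) x = _ := h2.fderiv
  rw [h3]; rfl

lemma dcmp_apply (i j : Fin 2) (v : 𝓢(E2, E2)) (x : E2) :
    dcmp i j v x = ((fderiv ℝ (fun y => v y i) x (EuclideanSpace.single j 1) : ℝ) : ℂ) := by
  unfold dcmp
  rw [SchwartzMap.lineDerivOp_apply_eq_fderiv]
  rw [comp_fderiv]
  have h1 : HasFDerivAt (fun y => v y) (fderiv ℝ (fun y => v y) x) x := v.differentiableAt.hasFDerivAt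
  have h2 := ((Complex.ofRealCLM ∘L (EuclideanSpace.proj i : E2 →L[ℝ] ℝ)).hasFDerivAt).comp x h1
  have h3 : fderiv ℝ (vcmp i v) x = _ := h2.fderiv
  rw [h3]; rfl

lemma dcmp_fourier (i j : Fin 2) (v : 𝓢(E2, E2)) (ξ : E2) :
    𝓕 (dcmp i j v : E2 → ℂ) ξ = (2 * π * Complex.I) * ((ξ j : ℝ) * 𝓕 (vcmp i v : E2 → ℂ) ξ) := by
  rw [← SchwartzMap.fourier_coe, ← SchwartzMap.fourier_coe]
  unfold dcmp
  rw [SchwartzMap.fourier_lineDerivOp_eq, smul_apply,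
    SchwartzMap.smulLeftCLM_apply_apply (by fun_prop)]
  simp [EuclideanSpace.inner_single_right]

lemma norm_dcmp_fourier (i j : Fin 2) (v : 𝓢(E2, E2)) (ξ : E2) :
    ‖𝓕 (dcmp i j v : E2 → ℂ) ξ‖ = (2 * π) * (|ξ j| * ‖𝓕 (vcmp i v : E2 → ℂ) ξ‖) := by
  rw [dcmp_fourier]
  simp [abs_of_pos Real.pi_pos]

lemma dcmp_inv (i j : Fin 2) (v : 𝓢(E2, E2)) :
    𝓕⁻ (𝓕 (dcmp i j v : E2 → ℂ)) = (dcmp i j v : E2 → ℂ) := by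
  rw [← SchwartzMap.fourier_coe, ← SchwartzMap.fourierInv_coe]
  simp

/-- symbol of the Riesz-type operator -/
def g0 (F : Fin 2 → E2 → ℂ) (ξ : E2) : ℂ :=
  Complex.I * (∑ i : Fin 2, (ξ i : ℂ) * F i ξ) / (‖ξ‖ : ℂ)

lemma norm_g0 (F : Fin 2 → E2 → ℂ) (ξ : E2) : ‖g0 F ξ‖ ≤ ∑ i, ‖F i ξ‖ := by
  unfold g0
  rw [norm_div, norm_mul, Complex.norm_I, one_mul, Complex.norm_real, norm_norm]
  by_cases h : ‖ξ‖ = 0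
  · rw [h, _root_.div_zero]; positivity
  have hp : 0 < ‖ξ‖ := lt_of_le_of_ne (norm_nonneg _) (Ne.symm h)
  rw [div_le_iff₀ hp, Finset.sum_mul]
  refine (norm_sum_le _ _).trans (Finset.sum_le_sum fun i _ => ?_)
  rw [norm_mul, Complex.norm_real, mul_comm]
  gcongr
  exact PiLp.norm_apply_le ξ i

lemma g0_meas (F : Fin 2 → E2 → ℂ) (hF : ∀ i, Measurable (F i)) : Measurable (g0 F) := by
  unfold g0
  fun_prop

lemma g0_contAt (F : Fin 2 → E2 → ℂ) (hF : ∀ i, Continuous (F i)) (ξ : E2) (h : ξ ≠ 0) :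
    ContinuousAt (g0 F) ξ := by
  unfold g0
  have : (‖ξ‖ : ℂ) ≠ 0 := by simpa using h
  fun_prop (disch := assumption)

lemma g0_int (F : Fin 2 → 𝓢(E2, ℂ)) (k : ℕ) :
    Integrable (fun ξ => ‖ξ‖ ^ k * ‖g0 (fun i => F i) ξ‖) := by
  have h : Integrable (fun ξ => ∑ i, ‖ξ‖ ^ k * ‖F i ξ‖) :=
    integrable_finsetSum _ fun i _ => (F i).integrable_pow_mul volume k
  refine h.mono' ?_ (Eventually.of_forall fun ξ => ?_)
  · have := g0_meas (fun i => F i) (fun i => (F i).continuous.measurable)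
    exact Measurable.aestronglyMeasurable (by fun_prop)
  · rw [Real.norm_of_nonneg (by positivity), ← Finset.mul_sum]
    gcongr
    exact norm_g0 _ _

lemma g0_int' (F : Fin 2 → 𝓢(E2, ℂ)) : Integrable (g0 (fun i => F i)) := by
  have := g0_int F 0
  simp only [pow_zero, one_mul] at this
  refine (integrable_norm_iff ?_).1 this
  exact (g0_meas (fun i => F i) (fun i => (F i).continuous.measurable)).aestronglyMeasurable

lemma fderiv_fourierInv (g : E2 → ℂ) (hg : Integrable g) (hg' : Integrable (fun ξ => ‖ξ‖ * ‖g ξ‖))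
    (x : E2) (j : Fin 2) :
    fderiv ℝ (𝓕⁻ g) x (EuclideanSpace.single j 1) =
      𝓕⁻ (fun ξ => (2 * π * Complex.I) * ((ξ j : ℝ) * g ξ)) x := by
  have hn : Integrable (fun ξ => g (-ξ)) := hg.comp_neg
  have hn' : Integrable (fun ξ => ‖ξ‖ * ‖g (-ξ)‖) := by simpa using hg'.comp_neg
  have e : 𝓕⁻ g = 𝓕 (fun ξ => g (-ξ)) := Real.fourierInv_eq_fourier_comp_neg g
  rw [e, Real.fderiv_fourier hn hn', Real.fourier_continuousLinearMap_apply,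
    Real.fourierInv_eq_fourier_comp_neg]
  · refine congrFun (congrArg _ (funext fun ξ => ?_)) x
    rw [VectorFourier.fourierSMulRight_apply]
    have hi : ∀ η : E2, (inner ℝ η (EuclideanSpace.single j (1 : ℝ)) : ℝ) = η j := fun η => by
      simp [EuclideanSpace.inner_single_right]
    simp
    left
    exact hi ξ
  · refine (hn'.const_mul (2 * π * ‖innerSL ℝ (E := E2)‖)).mono' hn.1.fourierSMulRight
      (Eventually.of_forall fun v => ?_)
    exact (VectorFourier.norm_fourierSMulRight_le _ _ _).trans (le_of_eq (by ring))

lemma hd_le_sum {κ : Type*} [Fintype κ] (σ : ℝ) (h : E2 → ℂ) (F : κ → E2 → ℂ)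
    (hF : ∀ i, Measurable (F i)) (hb : ∀ᵐ ξ, ‖h ξ‖ ≤ ∑ i, ‖F i ξ‖) :
    hd σ h ≤ ∑ i, hd σ (F i) := by
  unfold hd
  calc _ ≤ eLpNorm (∑ i, fun ξ : E2 => ‖ξ‖ ^ σ * ‖F i ξ‖) 2 volume := by
        refine eLpNorm_mono_ae ?_
        filter_upwards [hb] with ξ hξ
        rw [Finset.sum_apply, Real.norm_of_nonneg (by positivity),
          Real.norm_of_nonneg (Finset.sum_nonneg fun i _ => by positivity), ← Finset.mul_sum]
        gcongr
    _ ≤ _ := eLpNorm_sum_le (fun i _ => Measurable.aestronglyMeasurable (by have := hF i; fun_prop))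
        (by norm_num)

lemma hd_zero (h : E2 → ℂ) : hd 0 h = eLpNorm h 2 volume := by
  unfold hd
  simp

lemma hd_dcmp (s : ℝ) (hs : 2 < s) (i j : Fin 2) (v : 𝓢(E2, E2)) :
    hd (s - 1) (𝓕 (dcmp i j v : E2 → ℂ)) ≤ ENNReal.ofReal (2 * π) * hd s (𝓕 (vcmp i v : E2 → ℂ)) := by
  unfold hd
  have : ENNReal.ofReal (2 * π) * eLpNorm (fun ξ : E2 => ‖ξ‖ ^ s * ‖𝓕 (vcmp i v : E2 → ℂ) ξ‖) 2 volume
    = eLpNorm ((2 * π) • (fun ξ : E2 => ‖ξ‖ ^ s * ‖𝓕 (vcmp i v : E2 → ℂ) ξ‖)) 2 volume := by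
    rw [eLpNorm_const_smul, Real.enorm_of_nonneg (by positivity)]
  rw [this]
  refine eLpNorm_mono fun ξ => ?_
  rw [Pi.smul_apply, smul_eq_mul, Real.norm_of_nonneg (by positivity),
    Real.norm_of_nonneg (by positivity), norm_dcmp_fourier]
  have e : ‖ξ‖ ^ s = ‖ξ‖ ^ (s - 1) * ‖ξ‖ := by
    have := Real.rpow_add_one' (norm_nonneg ξ) (y := s - 1) (by linarith)
    simpa using this
  have hj : |ξ j| ≤ ‖ξ‖ := by simpa using PiLp.norm_apply_le ξ j
  rw [e]
  calc _ = 2 * π * (‖ξ‖ ^ (s - 1) * |ξ j| * ‖𝓕 (vcmp i v : E2 → ℂ) ξ‖) := by ring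
    _ ≤ _ := by gcongr

lemma fourier_meas (f : 𝓢(E2, ℂ)) : Measurable (𝓕 (f : E2 → ℂ)) := by
  rw [← SchwartzMap.fourier_coe]; exact (SchwartzMap.continuous _).measurable

lemma fourier_memLp (f : 𝓢(E2, ℂ)) : MemLp (𝓕 (f : E2 → ℂ)) 2 volume := by
  rw [← SchwartzMap.fourier_coe]; exact SchwartzMap.memLp _ 2 volume

lemma fourier_integrable (f : 𝓢(E2, ℂ)) : Integrable (𝓕 (f : E2 → ℂ)) volume := by
  rw [← SchwartzMap.fourier_coe]; exact SchwartzMap.integrable _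

/-- convolution with the Fourier transform of `f` -/
def cnv (f : 𝓢(E2, ℂ)) (h : E2 → ℂ) (ξ : E2) : ℂ := ∫ η, 𝓕 (f : E2 → ℂ) (ξ - η) * h η

lemma cnv_meas (f : 𝓢(E2, ℂ)) (h : E2 → ℂ) (hm : Measurable h) : Measurable (cnv f h) := by
  have hf := fourier_meas f
  have : StronglyMeasurable (fun p : E2 × E2 => 𝓕 (f : E2 → ℂ) (p.1 - p.2) * h p.2) :=
    Measurable.stronglyMeasurable (by fun_prop)
  exact this.integral_prod_right'.measurable

lemma dom_memLp (j : Fin 2) (v : 𝓢(E2, E2)) (h : E2 → ℂ) (hm : Measurable h)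
    (hb : ∀ ξ, ‖h ξ‖ ≤ ∑ i, ‖𝓕 (dcmp i j v : E2 → ℂ) ξ‖) : MemLp h 2 volume := by
  have : MemLp (fun ξ => ∑ i, ‖𝓕 (dcmp i j v : E2 → ℂ) ξ‖) 2 volume :=
    memLp_finsetSum _ fun i _ => (fourier_memLp _).norm
  refine this.mono hm.aestronglyMeasurable (Eventually.of_forall fun ξ => (hb ξ).trans (le_abs_self _))

lemma dom_integrable (j : Fin 2) (v : 𝓢(E2, E2)) (h : E2 → ℂ) (hm : Measurable h)
    (hb : ∀ ξ, ‖h ξ‖ ≤ ∑ i, ‖𝓕 (dcmp i j v : E2 → ℂ) ξ‖) : Integrable h volume := by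
  have : Integrable (fun ξ => ∑ i, ‖𝓕 (dcmp i j v : E2 → ℂ) ξ‖) volume :=
    integrable_finsetSum _ fun i _ => (fourier_integrable _).norm
  exact this.mono' hm.aestronglyMeasurable (Eventually.of_forall hb)

/-- the right-hand side -/
def rhs (s ι : ℝ) (u v : 𝓢(E2, E2)) : ℝ≥0∞ :=
  eLpNorm (fun x => u x) ⊤ volume * (∑ i : Fin 2, hd s (𝓕 (vcmp i v : E2 → ℂ)))
  + (∑ i : Fin 2, ∑ j : Fin 2, (eLpNorm (dcmp i j v) 2 volume + hd (1 + ι) (𝓕 (dcmp i j v : E2 → ℂ))))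
    * (∑ i : Fin 2, hd (s - 1) (𝓕 (vcmp i u : E2 → ℂ)))

lemma conv_bound (s ι : ℝ) (hs : 2 < s) (hι : 0 < ι) : ∃ C : NNReal,
    ∀ (u v : 𝓢(E2, E2)) (k j : Fin 2) (h : E2 → ℂ), Measurable h →
    (∀ ξ, ‖h ξ‖ ≤ ∑ i, ‖𝓕 (dcmp i j v : E2 → ℂ) ξ‖) →
    hd (s - 1) (cnv (vcmp k u) h) ≤ C * rhs s ι u v := by
  obtain ⟨C1, hC1⟩ := hd_core (s - 1) (by linarith)
  obtain ⟨C2, hC2⟩ := aux_L1 ι hι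
  refine ⟨C1 * (Real.toNNReal (2 * π) + C2), fun u v k j h hm hb => ?_⟩
  set U := eLpNorm (fun x => u x) ⊤ volume with hU
  have hUf : U ≠ ⊤ := (u.memLp ⊤ volume).2.ne
  have hB : ∀ᵐ x, ‖vcmp k u x‖ ≤ U.toNNReal := by
    have h1 : ∀ᵐ x, ‖u x‖ₑ ≤ U := by
      rw [hU, eLpNorm_exponent_top]; exact ae_le_eLpNormEssSup
    filter_upwards [h1] with x hx
    have h2 : ‖vcmp k u x‖ ≤ ‖u x‖ := by
      rw [vcmp_apply, Complex.norm_real]; exact PiLp.norm_apply_le _ _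
    refine h2.trans ?_
    have := ENNReal.toReal_mono hUf hx
    rw [toReal_enorm] at this
    exact this
  have main := hC1 (vcmp k u) U.toNNReal hB h hm (dom_memLp j v h hm hb)
  rw [ENNReal.coe_toNNReal hUf] at main
  have hm' : ∀ i, Measurable (𝓕 (dcmp i j v : E2 → ℂ)) := fun i => fourier_meas _
  have b1 : hd (s - 1) h ≤ ENNReal.ofReal (2 * π) * ∑ i, hd s (𝓕 (vcmp i v : E2 → ℂ)) := by
    refine (hd_le_sum (s - 1) h _ hm' (Eventually.of_forall hb)).trans ?_
    rw [Finset.mul_sum]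
    exact Finset.sum_le_sum fun i _ => hd_dcmp s hs i j v
  have b2 : ∫⁻ ξ, ‖h ξ‖ₑ ≤ C2 * ∑ i : Fin 2, ∑ j : Fin 2,
      (eLpNorm (dcmp i j v) 2 volume + hd (1 + ι) (𝓕 (dcmp i j v : E2 → ℂ))) := by
    refine (hC2 h hm).trans ?_
    gcongr
    have t1 := hd_le_sum 0 h _ hm' (Eventually.of_forall hb)
    have t2 := hd_le_sum (1 + ι) h _ hm' (Eventually.of_forall hb)
    simp only [hd_zero, aux_plancherel] at t1
    refine (add_le_add t1 t2).trans ?_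
    rw [← Finset.sum_add_distrib]
    refine Finset.sum_le_sum fun i _ => ?_
    exact Finset.single_le_sum (f := fun j => eLpNorm (dcmp i j v) 2 volume + hd (1 + ι) (𝓕 (dcmp i j v : E2 → ℂ)))
      (fun _ _ => bot_le) (Finset.mem_univ j)
  have b3 : hd (s - 1) (𝓕 (vcmp k u : E2 → ℂ)) ≤ ∑ i : Fin 2, hd (s - 1) (𝓕 (vcmp i u : E2 → ℂ)) :=
    Finset.single_le_sum (f := fun i => hd (s - 1) (𝓕 (vcmp i u : E2 → ℂ)))
      (fun _ _ => bot_le) (Finset.mem_univ k)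
  refine main.trans ?_
  have e : ENNReal.ofReal (2 * π) = ((Real.toNNReal (2 * π) : NNReal) : ℝ≥0∞) := rfl
  rw [e] at b1
  push_cast
  rw [mul_assoc]
  gcongr
  unfold rhs
  rw [← hU]
  refine (add_le_add (mul_le_mul_right b1 U) (mul_le_mul' b2 b3)).trans ?_
  generalize ((Real.toNNReal (2 * π) : NNReal) : ℝ≥0∞) = p
  generalize (∑ i : Fin 2, hd s (𝓕 (vcmp i v : E2 → ℂ))) = P
  generalize (∑ i : Fin 2, hd (s - 1) (𝓕 (vcmp i u : E2 → ℂ))) = Q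
  generalize (∑ i : Fin 2, ∑ j : Fin 2, (eLpNorm (dcmp i j v) 2 volume + hd (1 + ι) (𝓕 (dcmp i j v : E2 → ℂ)))) = S
  calc _ ≤ U * (p * P) + C2 * S * Q + (C2 * (U * P) + p * (S * Q)) := le_self_add
    _ = _ := by ring

/-- the Schwartz function `(u·∇v)_i` -/
def adv (i : Fin 2) (u v : 𝓢(E2, E2)) : 𝓢(E2, ℂ) :=
  ∑ j : Fin 2, SchwartzMap.smulLeftCLM ℂ (vcmp j u) (dcmp i j v)

lemma adv_apply (i : Fin 2) (u v : 𝓢(E2, E2)) (x : E2) :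
    adv i u v x = ∑ j : Fin 2, vcmp j u x * dcmp i j v x := by
  unfold adv
  rw [sum_apply]
  refine Finset.sum_congr rfl fun j _ => ?_
  rw [SchwartzMap.smulLeftCLM_apply_apply (SchwartzMap.hasTemperateGrowth _), smul_eq_mul]

lemma adv_eq (i : Fin 2) (u v : 𝓢(E2, E2)) :
    (fun y => (((∑ j : Fin 2, u y j • fderiv ℝ (fun z => v z) y (EuclideanSpace.single j 1)) i : ℝ) : ℂ))
      = adv i u v := by
  funext y
  rw [adv_apply]
  simp only [dcmp_apply, comp_fderiv, vcmp_apply]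
  simp

lemma prod_fourier (f : 𝓢(E2, ℂ)) (h : E2 → ℂ) (hh : Integrable h) :
    𝓕 (fun x => f x * 𝓕⁻ h x) = cnv f h := by
  funext ξ
  exact aux_conv_fourier f.integrable hh ξ

lemma prod_integrable (f : 𝓢(E2, ℂ)) (h : E2 → ℂ) (hh : Integrable h) :
    Integrable (fun x => f x * 𝓕⁻ h x) := by
  have hb : ∀ x, ‖𝓕⁻ h x‖ ≤ ∫ η, ‖h η‖ := by
    intro x
    rw [Real.fourierInv_eq]
    refine (norm_integral_le_integral_norm _).trans (le_of_eq ?_)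
    simp
  have hc : Continuous (𝓕⁻ h) := by
    rw [Real.fourierInv_eq_fourier_comp_neg]
    have := VectorFourier.fourierIntegral_continuous (μ := volume) (L := innerₗ E2) (e := 𝐞)
      Real.continuous_fourierChar (by simp only [innerₗ_apply_apply]; fun_prop) hh.comp_neg
    exact this
  exact f.integrable.mul_bdd (c := ∫ η, ‖h η‖) hc.aestronglyMeasurable (Eventually.of_forall hb)

lemma adv_fourier (i : Fin 2) (u v : 𝓢(E2, E2)) (ξ : E2) :
    𝓕 (adv i u v : E2 → ℂ) ξ = ∑ j : Fin 2, cnv (vcmp j u) (𝓕 (dcmp i j v : E2 → ℂ)) ξ := by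
  have e : (adv i u v : E2 → ℂ) = fun x => ∑ j : Fin 2, vcmp j u x * 𝓕⁻ (𝓕 (dcmp i j v : E2 → ℂ)) x := by
    funext x
    rw [adv_apply]
    simp only [dcmp_inv]
  rw [e]
  simp only [← prod_fourier _ _ (fourier_integrable _)]
  rw [Real.fourier_eq]
  simp only [Finset.smul_sum]
  rw [integral_finsetSum]
  · rfl
  · intro j _
    exact (Real.fourierIntegral_convergent_iff ξ).2 (prod_integrable _ _ (fourier_integrable _))

/-- symbol of `∂_j ℛ v` -/
def hR (j : Fin 2) (v : 𝓢(E2, E2)) (ξ : E2) : ℂ :=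
  (2 * π * Complex.I) * ((ξ j : ℝ) * g0 (fun i => 𝓕 (vcmp i v : E2 → ℂ)) ξ)

lemma hR_meas (j : Fin 2) (v : 𝓢(E2, E2)) : Measurable (hR j v) := by
  have := g0_meas (fun i => 𝓕 (vcmp i v : E2 → ℂ)) (fun i => fourier_meas _)
  unfold hR
  fun_prop

lemma hR_bound (j : Fin 2) (v : 𝓢(E2, E2)) (ξ : E2) :
    ‖hR j v ξ‖ ≤ ∑ i, ‖𝓕 (dcmp i j v : E2 → ℂ) ξ‖ := by
  simp only [norm_dcmp_fourier, ← Finset.mul_sum]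
  have := norm_g0 (fun i => 𝓕 (vcmp i v : E2 → ℂ)) ξ
  have e : ‖hR j v ξ‖ = (2 * π) * (|ξ j| * ‖g0 (fun i => 𝓕 (vcmp i v : E2 → ℂ)) ξ‖) := by
    unfold hR
    simp [abs_of_pos Real.pi_pos]
  rw [e]
  gcongr

lemma rieszDiv_fderiv (v : 𝓢(E2, E2)) (x : E2) (j : Fin 2) :
    fderiv ℝ (rieszDiv (fun y => v y)) x (EuclideanSpace.single j 1) = 𝓕⁻ (hR j v) x := by
  have e : rieszDiv (fun y => v y) = 𝓕⁻ (g0 (fun i => 𝓕 (vcmp i v : E2 → ℂ))) := rfl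
  have i1 := g0_int' (fun i => (𝓕 (vcmp i v) : 𝓢(E2, ℂ)))
  have i2 := g0_int (fun i => (𝓕 (vcmp i v) : 𝓢(E2, ℂ))) 1
  simp only [SchwartzMap.fourier_coe, pow_one] at i1 i2
  rw [e, fderiv_fourierInv _ i1 i2]
  rfl

lemma rieszDiv_adv (u v : 𝓢(E2, E2)) :
    rieszDiv (fun y => ∑ j : Fin 2, u y j • fderiv ℝ (fun z => v z) y (EuclideanSpace.single j 1))
      = 𝓕⁻ (g0 (fun i => 𝓕 (adv i u v : E2 → ℂ))) := by
  unfold rieszDiv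
  simp only [adv_eq]
  rfl

lemma comm_bound (u v : 𝓢(E2, E2)) (G : E2 → ℂ)
    (hG : G = fun x => 𝓕⁻ (g0 (fun i => 𝓕 (adv i u v : E2 → ℂ))) x
      - ∑ j : Fin 2, vcmp j u x * 𝓕⁻ (hR j v) x) :
    ∀ᵐ ξ, ‖𝓕 G ξ‖ ≤ ∑ k : Option (Fin 2) × Fin 2,
      ‖cnv (vcmp k.2 u) (k.1.elim (hR k.2 v) (fun i => 𝓕 (dcmp i k.2 v : E2 → ℂ))) ξ‖ := by
  by_cases hGi : Integrable G
  swap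
  · refine Eventually.of_forall fun ξ => ?_
    have : 𝓕 G ξ = 0 := by
      rw [Real.fourier_eq]
      exact integral_undef (fun h => hGi ((Real.fourierIntegral_convergent_iff ξ).1 h))
    rw [this, norm_zero]
    positivity
  set g1 := g0 (fun i => 𝓕 (adv i u v : E2 → ℂ)) with hg1
  have hRi : ∀ j, Integrable (hR j v) := fun j => dom_integrable j v _ (hR_meas j v) (hR_bound j v)
  have hP : ∀ j, Integrable (fun x => vcmp j u x * 𝓕⁻ (hR j v) x) := fun j =>
    prod_integrable _ _ (hRi j)
  have hPs : Integrable (fun x => ∑ j : Fin 2, vcmp j u x * 𝓕⁻ (hR j v) x) :=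
    integrable_finsetSum _ fun j _ => hP j
  have hI : Integrable (𝓕⁻ g1) := by
    have : 𝓕⁻ g1 = fun x => G x + ∑ j : Fin 2, vcmp j u x * 𝓕⁻ (hR j v) x := by
      funext x; rw [hG]; simp
    rw [this]; exact hGi.add hPs
  have hI' : Integrable (𝓕 g1) := by
    have : 𝓕 g1 = fun x => 𝓕⁻ g1 (-x) := by
      funext x; rw [Real.fourierInv_eq_fourier_neg, neg_neg]
    rw [this]; exact hI.comp_neg
  have hg1i : Integrable g1 := by
    have i1 := g0_int' (fun i => (𝓕 (adv i u v) : 𝓢(E2, ℂ)))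
    simp only [SchwartzMap.fourier_coe] at i1
    exact i1
  have hne : ∀ᵐ ξ : E2, ξ ≠ 0 := by
    rw [ae_iff]; simp
  filter_upwards [hne] with ξ hξ
  have hca : ContinuousAt g1 ξ := by
    refine g0_contAt _ (fun i => ?_) ξ hξ
    rw [← SchwartzMap.fourier_coe]; exact SchwartzMap.continuous _
  have hinv : 𝓕 (𝓕⁻ g1) ξ = g1 ξ := MeasureTheory.Integrable.fourier_fourierInv_eq hg1i hI' hca
  have hsum : 𝓕 (fun x => ∑ j : Fin 2, vcmp j u x * 𝓕⁻ (hR j v) x) ξ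
      = ∑ j : Fin 2, cnv (vcmp j u) (hR j v) ξ := by
    simp only [← prod_fourier _ _ (hRi _)]
    rw [Real.fourier_eq]
    simp only [Finset.smul_sum]
    rw [integral_finsetSum]
    · rfl
    · intro j _
      exact (Real.fourierIntegral_convergent_iff ξ).2 (hP j)
  have hGf : 𝓕 G ξ = g1 ξ - ∑ j : Fin 2, cnv (vcmp j u) (hR j v) ξ := by
    rw [← hsum, ← hinv, hG]
    simp only [Real.fourier_eq, smul_sub]
    exact integral_sub ((Real.fourierIntegral_convergent_iff ξ).2 hI)
      ((Real.fourierIntegral_convergent_iff ξ).2 hPs)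
  rw [hGf, Fintype.sum_prod_type, Fintype.sum_option]
  refine (norm_sub_le _ _).trans ?_
  rw [add_comm]
  refine add_le_add (norm_sum_le _ _) ?_
  refine (norm_g0 _ ξ).trans (Finset.sum_le_sum fun i _ => ?_)
  rw [adv_fourier]
  exact norm_sum_le _ _

lemma hdotNorm_eq (σ : ℝ) (f : E2 → ℂ) : hdotNorm σ f = hd σ (𝓕 f) := rfl

/-- for `ℛ = Λ^{−1} div`, a smooth divergence-free `u` and smooth `v`
(rapidly decaying) on `ℝ²`, `s > 2` and `ι ∈ (0, s−2)`:
`‖ℛ(u·∇v) − u·∇(ℛv)‖_{Ḣ^{s−1}} ≤ C (‖u‖_{L^∞} ‖v‖_{Ḣ^s} + ‖∇v‖_{H^{1+ι}} ‖u‖_{Ḣ^{s−1}})`. -/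
theorem stmt_12 (s ι : ℝ) (hs : 2 < s) (hι : 0 < ι) (hιs : ι < s - 2) :
    ∃ C : ℝ, 0 < C ∧
      ∀ (u v : SchwartzMap (EuclideanSpace ℝ (Fin 2)) (EuclideanSpace ℝ (Fin 2))),
        (∀ x, (∑ i : Fin 2,
          fderiv ℝ (fun y => u y i) x (EuclideanSpace.single i 1)) = 0) →
        hdotNorm (s - 1)
          (fun x =>
            rieszDiv (fun y => ∑ j : Fin 2,
              u y j • fderiv ℝ (fun z => v z) y (EuclideanSpace.single j 1)) x
            - ∑ j : Fin 2,
                (u x j : ℂ) * fderiv ℝ (rieszDiv (fun y => v y)) x (EuclideanSpace.single j 1))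
          ≤ ENNReal.ofReal C *
            (eLpNorm (fun x => u x) ⊤ volume
                * (∑ i : Fin 2, hdotNorm s (fun x => ((v x i : ℝ) : ℂ)))
              + (∑ i : Fin 2, ∑ j : Fin 2, sobNorm (1 + ι)
                  (fun x => ((fderiv ℝ (fun y => v y i) x (EuclideanSpace.single j 1) : ℝ) : ℂ)))
                * (∑ i : Fin 2, hdotNorm (s - 1) (fun x => ((u x i : ℝ) : ℂ)))) := by
  obtain ⟨C, hC⟩ := conv_bound s ι hs hι
  refine ⟨6 * C + 1, by positivity, fun u v _ => ?_⟩
  have hr : (eLpNorm (fun x => u x) ⊤ volume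
                * (∑ i : Fin 2, hdotNorm s (fun x => ((v x i : ℝ) : ℂ)))
              + (∑ i : Fin 2, ∑ j : Fin 2, sobNorm (1 + ι)
                  (fun x => ((fderiv ℝ (fun y => v y i) x (EuclideanSpace.single j 1) : ℝ) : ℂ)))
                * (∑ i : Fin 2, hdotNorm (s - 1) (fun x => ((u x i : ℝ) : ℂ)))) = rhs s ι u v := by
    simp only [← dcmp_apply]
    unfold rhs sobNorm
    simp only [hdotNorm_eq]
    rfl
  rw [hr, rieszDiv_adv]
  simp only [rieszDiv_fderiv]
  simp only [← vcmp_apply]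
  rw [hdotNorm_eq]
  generalize hG : (fun x => 𝓕⁻ (g0 (fun i => 𝓕 (adv i u v : E2 → ℂ))) x
      - ∑ j : Fin 2, vcmp j u x * 𝓕⁻ (hR j v) x) = G
  have hb := comm_bound u v G hG.symm
  have hm : ∀ k : Option (Fin 2) × Fin 2, Measurable
      (k.1.elim (hR k.2 v) (fun i => 𝓕 (dcmp i k.2 v : E2 → ℂ))) := by
    rintro ⟨_ | i, j⟩
    · exact hR_meas j v
    · exact fourier_meas _
  have h1 := hd_le_sum (κ := Option (Fin 2) × Fin 2) (s - 1) (𝓕 G)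
    (fun k => cnv (vcmp k.2 u) (k.1.elim (hR k.2 v) (fun i => 𝓕 (dcmp i k.2 v : E2 → ℂ))))
    (fun k => cnv_meas (vcmp k.2 u) _ (hm k)) hb
  refine h1.trans ?_
  have h2 : ∀ k : Option (Fin 2) × Fin 2, hd (s - 1)
      (cnv (vcmp k.2 u) (k.1.elim (hR k.2 v) (fun i => 𝓕 (dcmp i k.2 v : E2 → ℂ)))) ≤
      C * rhs s ι u v := by
    intro k
    refine hC u v k.2 k.2 _ (hm k) ?_
    rcases k with ⟨_ | i, j⟩
    · exact hR_bound j v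
    · intro ξ
      exact Finset.single_le_sum (f := fun i => ‖𝓕 (dcmp i j v : E2 → ℂ) ξ‖)
        (fun _ _ => norm_nonneg _) (Finset.mem_univ i)
  refine (Finset.sum_le_sum fun k _ => h2 k).trans ?_
  rw [Finset.sum_const, nsmul_eq_mul, ← mul_assoc]
  gcongr
  rw [ENNReal.ofReal_add (by positivity) zero_le_one, ENNReal.ofReal_mul (by norm_num),
    ENNReal.ofReal_coe_nnreal]
  have : (Finset.univ : Finset (Option (Fin 2) × Fin 2)).card = 6 := rfl
  rw [this]
  simp
end
end
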